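/- arXiv:2403.06219 — 13 statements merged into one kernel-verified Lean document; each statement's English description precedes it below -/
import Mathlib

section
/- Let S, M₁, M₂ be additive commutative monoids and let f : S → M₁ and g : S → M₂ be additive monoid homomorphisms. Then the fibered-sum relation ~ on M₁ × M₂ is an additive congruence: it is reflexive, symmetric, transitive, and whenever (s₁, s₂) ~ (t₁, t₂) and (u₁, u₂) ~ (v₁, v₂), one has (s₁ + u₁, s₂ + u₂) ~ (t₁ + v₁, t₂ + v₂). -/
/-- The fibered-sum relation on `M₁ × M₂` induced by additive monoid homomorphisms
`f : S →+ M₁` and `g : S →+ M₂`:  `(s₁, s₂) ~ (t₁, t₂)` iff there exist `a b : S` with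
`s₁ + f a = t₁ + f b` and `s₂ + g b = t₂ + g a`. -/
def FiberedSumRel {S M₁ M₂ : Type*} [AddCommMonoid S] [AddCommMonoid M₁] [AddCommMonoid M₂]
    (f : S →+ M₁) (g : S →+ M₂) (p q : M₁ × M₂) : Prop :=
  ∃ a b : S, p.1 + f a = q.1 + f b ∧ p.2 + g b = q.2 + g a

/-- The fibered-sum relation is an additive congruence: it is reflexive, symmetric,
transitive, and compatible with addition. -/
theorem fiberedSumRel_isAddCongruence
    {S M₁ M₂ : Type*} [AddCommMonoid S] [AddCommMonoid M₁] [AddCommMonoid M₂]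
    (f : S →+ M₁) (g : S →+ M₂) :
    (∀ p : M₁ × M₂, FiberedSumRel f g p p) ∧
    (∀ p q : M₁ × M₂, FiberedSumRel f g p q → FiberedSumRel f g q p) ∧
    (∀ p q r : M₁ × M₂, FiberedSumRel f g p q → FiberedSumRel f g q r →
      FiberedSumRel f g p r) ∧
    (∀ (s₁ t₁ u₁ v₁ : M₁) (s₂ t₂ u₂ v₂ : M₂),
      FiberedSumRel f g (s₁, s₂) (t₁, t₂) → FiberedSumRel f g (u₁, u₂) (v₁, v₂) →
      FiberedSumRel f g (s₁ + u₁, s₂ + u₂) (t₁ + v₁, t₂ + v₂)) := by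
  refine ⟨fun p => ⟨0, 0, rfl, rfl⟩, ?_, ?_, ?_⟩
  · rintro p q ⟨a, b, h₁, h₂⟩
    exact ⟨b, a, h₁.symm, h₂.symm⟩
  · rintro p q r ⟨a, b, h₁, h₂⟩ ⟨c, d, k₁, k₂⟩
    refine ⟨a + c, b + d, ?_, ?_⟩
    · rw [map_add, map_add, ← add_assoc, h₁, add_right_comm, k₁, add_assoc, add_comm (f d)]
    · rw [map_add, map_add, ← add_assoc, h₂, add_right_comm, k₂, add_assoc, add_comm (g c)]
  · rintro s₁ t₁ u₁ v₁ s₂ t₂ u₂ v₂ ⟨a, b, h₁, h₂⟩ ⟨c, d, k₁, k₂⟩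
    refine ⟨a + c, b + d, ?_, ?_⟩
    · simpa only [map_add, add_add_add_comm] using congrArg₂ (· + ·) h₁ k₁
    · simpa only [map_add, add_add_add_comm] using congrArg₂ (· + ·) h₂ k₂
end

section
/- Let G be an abelian group, let S₁, S₂, S be additive submonoids of G with S ⊆ S₁ and S ⊆ S₂, and suppose there exists a positive integer n such that n•x ∈ gp(S) for every x ∈ S₁ and n•x ∈ gp(S) for every x ∈ S₂. Then for all s₁, t₁ ∈ S₁ and s₂, t₂ ∈ S₂ with s₁ + s₂ = t₁ + t₂, there exist a positive integer m and elements a, b ∈ S such that m•s₁ + a = m•t₁ + b and m•s₂ + b = m•t₂ + a. -/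
/-- Every element of the subgroup generated by a submonoid `S` of an abelian group is a
difference of two elements of `S`. -/
theorem AddSubmonoid.exists_sub_eq_of_mem_closure {G : Type*} [AddCommGroup G]
    (S : AddSubmonoid G) {x : G} (hx : x ∈ AddSubgroup.closure (S : Set G)) :
    ∃ a ∈ S, ∃ b ∈ S, a - b = x := by
  induction hx using AddSubgroup.closure_induction with
  | mem x hx => exact ⟨x, hx, 0, S.zero_mem, sub_zero x⟩
  | zero => exact ⟨0, S.zero_mem, 0, S.zero_mem, sub_zero 0⟩
  | add x y _ _ ihx ihy =>
    obtain ⟨a, ha, b, hb, rfl⟩ := ihx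
    obtain ⟨c, hc, d, hd, rfl⟩ := ihy
    exact ⟨a + c, S.add_mem ha hc, b + d, S.add_mem hb hd, add_sub_add_comm a c b d⟩
  | neg x _ ih =>
    obtain ⟨a, ha, b, hb, rfl⟩ := ih
    exact ⟨b, hb, a, ha, (neg_sub a b).symm⟩

/-- Let `S₁, S₂, S` be additive submonoids of an abelian group `G` with `S ⊆ S₁` and
`S ⊆ S₂`, and suppose some positive multiple of every element of `S₁` and of `S₂` lies in
the subgroup generated by `S`.  Then whenever `s₁ + s₂ = t₁ + t₂` with `s₁, t₁ ∈ S₁` and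
`s₂, t₂ ∈ S₂`, there are a positive integer `m` and `a, b ∈ S` with
`m • s₁ + a = m • t₁ + b` and `m • s₂ + b = m • t₂ + a`. -/
theorem fiberedSum_injectivity_of_rank_eq
    {G : Type*} [AddCommGroup G] (S₁ S₂ S : AddSubmonoid G)
    (h₁ : S ≤ S₁) (h₂ : S ≤ S₂)
    (hn : ∃ n : ℕ, 0 < n ∧
      (∀ x ∈ S₁, n • x ∈ AddSubgroup.closure (S : Set G)) ∧
      (∀ x ∈ S₂, n • x ∈ AddSubgroup.closure (S : Set G)))
    (s₁ t₁ : G) (hs₁ : s₁ ∈ S₁) (ht₁ : t₁ ∈ S₁)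
    (s₂ t₂ : G) (hs₂ : s₂ ∈ S₂) (ht₂ : t₂ ∈ S₂)
    (hsum : s₁ + s₂ = t₁ + t₂) :
    ∃ m : ℕ, 0 < m ∧ ∃ a ∈ S, ∃ b ∈ S,
      m • s₁ + a = m • t₁ + b ∧ m • s₂ + b = m • t₂ + a := by
  obtain ⟨n, hn0, hn₁, -⟩ := hn
  obtain ⟨b, hb, a, ha, hab⟩ := S.exists_sub_eq_of_mem_closure
    (AddSubgroup.sub_mem _ (hn₁ s₁ hs₁) (hn₁ t₁ ht₁))
  have hfst : n • s₁ + a = n • t₁ + b := by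
    rw [eq_add_of_sub_eq hab]
    abel
  refine ⟨n, hn0, a, ha, b, hb, hfst, ?_⟩
  have hsnd : n • s₁ + n • s₂ = n • t₁ + n • t₂ := by
    rw [← nsmul_add, ← nsmul_add, hsum]
  apply add_left_cancel (a := n • s₁)
  calc n • s₁ + (n • s₂ + b) = (n • s₁ + n • s₂) + b := (add_assoc _ _ _).symm
    _ = (n • t₁ + b) + n • t₂ := by rw [hsnd, add_right_comm]
    _ = n • s₁ + (n • t₂ + a) := by rw [← hfst, add_right_comm, add_assoc]
end

section
/- Let S₁ and S₂ be additive submonoids of ℕ and let S be an additive submonoid of ℕ contained in S₁ ∩ S₂ which contains a nonzero element. Then for all s₁, t₁ ∈ S₁ and s₂, t₂ ∈ S₂ with s₁ + s₂ = t₁ + t₂, there exist a positive integer m and elements a, b ∈ S such that m·s₁ + a = m·t₁ + b and m·s₂ + b = m·t₂ + a. -/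
/-- For additive submonoids `S₁, S₂` of `ℕ` and a submonoid `S ⊆ S₁ ∩ S₂` containing a
nonzero element: whenever `s₁ + s₂ = t₁ + t₂` with `s₁, t₁ ∈ S₁` and `s₂, t₂ ∈ S₂`, there
are a positive integer `m` and `a, b ∈ S` with `m * s₁ + a = m * t₁ + b` and
`m * s₂ + b = m * t₂ + a`. -/
theorem numerical_fiberedSum_injectivity
    (S₁ S₂ S : AddSubmonoid ℕ) (hS : S ≤ S₁ ⊓ S₂)
    (hne : ∃ x ∈ S, x ≠ 0)
    (s₁ t₁ : ℕ) (hs₁ : s₁ ∈ S₁) (ht₁ : t₁ ∈ S₁)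
    (s₂ t₂ : ℕ) (hs₂ : s₂ ∈ S₂) (ht₂ : t₂ ∈ S₂)
    (hsum : s₁ + s₂ = t₁ + t₂) :
    ∃ m : ℕ, 0 < m ∧ ∃ a ∈ S, ∃ b ∈ S,
      m * s₁ + a = m * t₁ + b ∧ m * s₂ + b = m * t₂ + a := by
  obtain ⟨x, hx, hx0⟩ := hne
  refine ⟨x, Nat.pos_of_ne_zero hx0, t₁ * x, S.nsmul_mem hx t₁, s₁ * x, S.nsmul_mem hx s₁,
    by ring, ?_⟩
  linear_combination x * hsum
end

section
/- Let G be an abelian group and let S₁, S₂, S be additive submonoids of G with S ⊆ S₁ ∩ S₂. Then the following are equivalent: (i) gp(S₁) ⊓ gp(S₂) = gp(S) as subgroups of G; (ii) for all s₁, t₁ ∈ S₁ and s₂, t₂ ∈ S₂ with s₁ + s₂ = t₁ + t₂, there exist a, b ∈ S such that s₁ + a = t₁ + b and s₂ + b = t₂ + a. -/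
/-- The subgroup generated by a submonoid of an abelian group consists of the differences of
elements of the submonoid. -/
theorem AddSubmonoid.mem_addSubgroup_closure_iff_exists_sub {G : Type*} [AddCommGroup G]
    (S : AddSubmonoid G) {x : G} :
    x ∈ AddSubgroup.closure (S : Set G) ↔ ∃ a ∈ S, ∃ b ∈ S, x = a - b := by
  constructor
  · intro hx
    induction hx using AddSubgroup.closure_induction with
    | mem x hx => exact ⟨x, hx, 0, S.zero_mem, (sub_zero x).symm⟩
    | zero => exact ⟨0, S.zero_mem, 0, S.zero_mem, (sub_zero 0).symm⟩
    | add x y _ _ hx hy =>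
      obtain ⟨a, ha, b, hb, rfl⟩ := hx
      obtain ⟨c, hc, d, hd, rfl⟩ := hy
      exact ⟨a + c, S.add_mem ha hc, b + d, S.add_mem hb hd, sub_add_sub_comm a b c d⟩
    | neg x _ hx =>
      obtain ⟨a, ha, b, hb, rfl⟩ := hx
      exact ⟨b, hb, a, ha, neg_sub a b⟩
  · rintro ⟨a, ha, b, hb, rfl⟩
    exact sub_mem (AddSubgroup.subset_closure ha) (AddSubgroup.subset_closure hb)

/-- For additive submonoids `S₁, S₂, S` of an abelian group `G` with `S ⊆ S₁ ∩ S₂`: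
`gp(S₁) ⊓ gp(S₂) = gp(S)` iff the canonical map from the fibered sum `S₁ ⊕_S S₂` to `G`,
sending the class of `(s₁, s₂)` to `s₁ + s₂`, is injective, the latter being expressed
element-wise. -/
theorem gp_inf_eq_gp_iff_fiberedSum_embeds
    {G : Type*} [AddCommGroup G] (S₁ S₂ S : AddSubmonoid G) (hS : S ≤ S₁ ⊓ S₂) :
    (AddSubgroup.closure (S₁ : Set G) ⊓ AddSubgroup.closure (S₂ : Set G)
        = AddSubgroup.closure (S : Set G)) ↔
    (∀ s₁ ∈ S₁, ∀ t₁ ∈ S₁, ∀ s₂ ∈ S₂, ∀ t₂ ∈ S₂, s₁ + s₂ = t₁ + t₂ →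
      ∃ a ∈ S, ∃ b ∈ S, s₁ + a = t₁ + b ∧ s₂ + b = t₂ + a) := by
  constructor
  · intro h s₁ hs₁ t₁ ht₁ s₂ hs₂ t₂ ht₂ hst
    have heq : s₁ - t₁ = t₂ - s₂ := by
      rw [sub_eq_sub_iff_add_eq_add, hst, add_comm]
    have hmem : s₁ - t₁ ∈ AddSubgroup.closure (S : Set G) := by
      rw [← h, AddSubgroup.mem_inf, S₁.mem_addSubgroup_closure_iff_exists_sub,
        S₂.mem_addSubgroup_closure_iff_exists_sub]
      exact ⟨⟨s₁, hs₁, t₁, ht₁, rfl⟩, ⟨t₂, ht₂, s₂, hs₂, heq⟩⟩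
    obtain ⟨b, hb, a, ha, hba⟩ := S.mem_addSubgroup_closure_iff_exists_sub.1 hmem
    refine ⟨a, ha, b, hb, ?_, ?_⟩
    · rw [sub_eq_sub_iff_add_eq_add.1 hba, add_comm]
    · rw [add_comm, ← sub_eq_sub_iff_add_eq_add.1 (heq.symm.trans hba)]
  · intro h
    refine le_antisymm (fun x hx => ?_) (le_inf
      (AddSubgroup.closure_mono fun x hx => (hS hx).1)
      (AddSubgroup.closure_mono fun x hx => (hS hx).2))
    obtain ⟨s₁, hs₁, t₁, ht₁, rfl⟩ := S₁.mem_addSubgroup_closure_iff_exists_sub.1 hx.1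
    obtain ⟨t₂, ht₂, s₂, hs₂, heq⟩ := S₂.mem_addSubgroup_closure_iff_exists_sub.1 hx.2
    obtain ⟨a, ha, b, hb, hab, -⟩ := h s₁ hs₁ t₁ ht₁ s₂ hs₂ t₂ ht₂
      ((sub_eq_sub_iff_add_eq_add.1 heq).trans (add_comm t₂ t₁))
    refine S.mem_addSubgroup_closure_iff_exists_sub.2 ⟨b, hb, a, ha, ?_⟩
    rw [sub_eq_sub_iff_add_eq_add, hab, add_comm]
end

section
/- Let S₁ and S₂ be additive submonoids of ℕ, regarded as subsets of ℤ. Then gp(S₁ ∩ S₂) = gp(S₁) ⊓ gp(S₂) as subgroups of ℤ. -/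
/-- All sufficiently large natural numbers in the subgroup of `ℤ` generated by an additive
submonoid of `ℕ` belong to the submonoid. -/
theorem AddSubmonoid.exists_forall_ge_mem_of_cast_mem_closure (S : AddSubmonoid ℕ) :
    ∃ N : ℕ, ∀ m ≥ N, (m : ℤ) ∈ AddSubgroup.closure ((Nat.cast : ℕ → ℤ) '' (S : Set ℕ)) →
      m ∈ S := by
  obtain ⟨N, hN⟩ := Nat.exists_mem_closure_of_ge (S : Set ℕ)
  refine ⟨N, fun m hm hmem => ?_⟩
  have hdvd : (Nat.setGcd (S : Set ℕ) : ℤ) ∣ m := by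
    refine AddSubgroup.closure_induction (p := fun x _ => (Nat.setGcd (S : Set ℕ) : ℤ) ∣ x)
      ?_ (dvd_zero _) (fun _ _ _ _ => dvd_add) (fun _ _ => (dvd_neg.mpr ·)) hmem
    rintro _ ⟨n, hn, rfl⟩
    exact Int.natCast_dvd_natCast.mpr (Nat.setGcd_dvd_of_mem hn)
  exact S.closure_eq.le (hN m hm (Int.natCast_dvd_natCast.mp hdvd))

/-- For additive submonoids `S₁, S₂` of `ℕ`, viewed inside `ℤ`, the subgroup generated by
`S₁ ∩ S₂` equals the intersection of the subgroups generated by `S₁` and by `S₂`. -/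
theorem gp_inter_eq_gp_inf_gp (S₁ S₂ : AddSubmonoid ℕ) :
    AddSubgroup.closure ((Nat.cast : ℕ → ℤ) '' ((S₁ ⊓ S₂ : AddSubmonoid ℕ) : Set ℕ)) =
      AddSubgroup.closure ((Nat.cast : ℕ → ℤ) '' (S₁ : Set ℕ)) ⊓
        AddSubgroup.closure ((Nat.cast : ℕ → ℤ) '' (S₂ : Set ℕ)) := by
  apply le_antisymm
  · exact le_inf
      (AddSubgroup.closure_mono (Set.image_mono fun _ h => h.1))
      (AddSubgroup.closure_mono (Set.image_mono fun _ h => h.2))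
  intro x hx
  obtain ⟨hx₁, hx₂⟩ := AddSubgroup.mem_inf.mp hx
  obtain ⟨N₁, h₁⟩ := S₁.exists_forall_ge_mem_of_cast_mem_closure
  obtain ⟨N₂, h₂⟩ := S₂.exists_forall_ge_mem_of_cast_mem_closure
  obtain rfl | hx₀ := eq_or_ne x 0
  · exact zero_mem _
  have hlarge (y : ℤ) (hy : (N₁ + N₂ : ℤ) ≤ y) (hdvd : x ∣ y) :
      y ∈ AddSubgroup.closure ((Nat.cast : ℕ → ℤ) '' ((S₁ ⊓ S₂ : AddSubmonoid ℕ) : Set ℕ)) := by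
    lift y to ℕ using by omega
    obtain ⟨k, hk⟩ := hdvd
    have hmul : (y : ℤ) = k • x := by rw [hk, smul_eq_mul, mul_comm]
    refine AddSubgroup.subset_closure ⟨y, ⟨h₁ y (by omega) ?_, h₂ y (by omega) ?_⟩, rfl⟩
    · exact hmul ▸ zsmul_mem hx₁ k
    · exact hmul ▸ zsmul_mem hx₂ k
  have habs : 1 ≤ |x| := Int.one_le_abs hx₀
  have hneg : -|x| ≤ x := neg_abs_le x
  have hself : x ∣ (N₁ + N₂ + 1 : ℤ) * |x| := (self_dvd_abs x).mul_left _
  have hle : (N₁ + N₂ : ℤ) ≤ (N₁ + N₂ : ℤ) * |x| :=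
    le_mul_of_one_le_right (by positivity) habs
  have hsub := sub_mem (hlarge (x + (N₁ + N₂ + 1) * |x|) (by linarith) (dvd_add dvd_rfl hself))
    (hlarge ((N₁ + N₂ + 1) * |x|) (by linarith) hself)
  rwa [add_sub_cancel_right] at hsub
end

section
/- Let d be a positive integer, let S' be an additive submonoid of ℕ^d, let s ∈ S' be a nonzero element, and let S be the submonoid of ℕ^d generated by s, i.e., S = {n•s : n ∈ ℕ}. Then every element x ∈ S' has a unique representation over S: there exist unique n ∈ ℕ and w ∈ S' with w Apéry over S and x = n•s + w. -/
/-- `w` is an Apéry element of `S'` over `S`: `w ∈ S'` and `w` cannot be written as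
`t + w'` with `0 ≠ t ∈ S` and `w' ∈ S'`. -/
def IsApery {M : Type*} [AddCommMonoid M] (S' S : AddSubmonoid M) (w : M) : Prop :=
  w ∈ S' ∧ ¬ ∃ t ∈ S, t ≠ 0 ∧ ∃ w' ∈ S', w = t + w'

/-- Over a submonoid generated by one element of a canonically ordered cancellative monoid with
well-founded order, every element of `S'` has a representation. -/
theorem exists_nsmul_add_isApery {M : Type*} [AddCommMonoid M] [IsLeftCancelAdd M]
    [PartialOrder M] [CanonicallyOrderedAdd M] [WellFoundedLT M] (S' : AddSubmonoid M) (s : M)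
    (x : M) (hx : x ∈ S') :
    ∃ n : ℕ, ∃ w, IsApery S' (AddSubmonoid.closure {s}) w ∧ x = n • s + w := by
  induction x using WellFoundedLT.induction with
  | ind x ih =>
    by_cases hA : IsApery S' (AddSubmonoid.closure {s}) x
    · exact ⟨0, x, hA, by simp⟩
    · obtain ⟨t, ht, ht0, y, hy, rfl⟩ := not_not.mp fun h => hA ⟨hx, h⟩
      have hlt : y < t + y := by
        refine lt_of_le_of_ne le_add_self fun h => ht0 ?_
        rwa [add_comm, left_eq_add] at h
      obtain ⟨n, w, hw, rfl⟩ := ih y hlt hy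
      obtain ⟨k, rfl⟩ := AddSubmonoid.mem_closure_singleton.mp ht
      exact ⟨k + n, w, hw, by rw [add_nsmul, add_assoc]⟩

/-- Over the submonoid generated by a non-torsion element `s`, the coefficient of an Apéry
representation is the largest `m` such that `m • s` can be split off inside `S'`. -/
theorem IsApery.le_of_nsmul_add_eq {M : Type*} [AddCommMonoid M] [IsLeftCancelAdd M]
    {S' : AddSubmonoid M} {s : M} (hs : ∀ k : ℕ, k ≠ 0 → k • s ≠ 0) {m n : ℕ} {v w : M}
    (hv : v ∈ S') (hw : IsApery S' (AddSubmonoid.closure {s}) w)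
    (h : m • s + v = n • s + w) : m ≤ n := by
  by_contra! hlt
  obtain ⟨k, rfl⟩ := Nat.exists_eq_add_of_lt hlt
  refine hw.2 ⟨(k + 1) • s, AddSubmonoid.mem_closure_singleton.mpr ⟨_, rfl⟩,
    hs _ k.succ_ne_zero, v, hv, ?_⟩
  rw [add_assoc n, add_nsmul, add_assoc] at h
  exact (add_left_cancel h).symm

/-- If `S'` is an additive submonoid of `ℕ^d`, `s ∈ S'` is nonzero, and `S = {n • s : n ∈ ℕ}`
is the submonoid generated by `s`, then every element of `S'` has a unique representation
`x = n • s + w` with `n ∈ ℕ` and `w ∈ S'` Apéry over `S`. -/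
theorem unique_representation_over_singleton
    (d : ℕ) (hd : 0 < d) (S' : AddSubmonoid (Fin d → ℕ)) (s : Fin d → ℕ)
    (hs : s ∈ S') (hs0 : s ≠ 0) :
    ∀ x ∈ S', ∃! p : ℕ × (Fin d → ℕ),
      p.2 ∈ S' ∧ IsApery S' (AddSubmonoid.closure {s}) p.2 ∧ x = p.1 • s + p.2 := by
  intro x hx
  have hs' : ∀ k : ℕ, k ≠ 0 → k • s ≠ 0 := fun k hk => smul_ne_zero hk hs0
  obtain ⟨n, w, hw, rfl⟩ := exists_nsmul_add_isApery S' s x hx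
  refine ⟨(n, w), ⟨hw.1, hw, rfl⟩, ?_⟩
  rintro ⟨m, v⟩ ⟨hv, hvA, h⟩
  obtain rfl : m = n :=
    le_antisymm (hw.le_of_nsmul_add_eq hs' hv h.symm) (hvA.le_of_nsmul_add_eq hs' hw.1 h)
  rw [add_left_cancel h]
end

section
/- Let S be an additive commutative monoid admitting an injective additive monoid homomorphism φ : S → ℕ, and let f : S → M₁ and g : S → M₂ be injective additive monoid homomorphisms into positive cancellative additive commutative monoids M₁ and M₂. If s₁ ∈ M₁, s₂ ∈ M₂ and a, b ∈ S satisfy s₁ + f(a) = f(b) in M₁ and s₂ + g(b) = g(a) in M₂, then s₁ = 0 and s₂ = 0. -/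
/-- Let `φ : S →+ ℕ` and `g : S →+ M` be injective, with `M` positive and cancellative.
If `g b` is a summand of `g a`, then `φ b ≤ φ a`. -/
theorem map_le_map_of_add_map_eq {S M : Type*} [AddCommMonoid S] [AddCommMonoid M]
    (φ : S →+ ℕ) (hφ : Function.Injective φ) (g : S →+ M) (hg : Function.Injective g)
    (hcancel : ∀ x y z : M, x + z = y + z → x = y)
    (hpos : ∀ x y : M, x + y = 0 → x = 0)
    {s : M} {a b : S} (h : s + g b = g a) : φ b ≤ φ a := by
  by_contra! hlt
  obtain ⟨d, hd⟩ := Nat.exists_eq_add_of_lt hlt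
  have hab : φ b • a = φ a • b := hφ (by simp [mul_comm])
  have hsum : (g b + (d • g b + φ b • s)) + φ a • g b = 0 + φ a • g b :=
    calc (g b + (d • g b + φ b • s)) + φ a • g b
        = φ b • s + (φ a + d + 1) • g b := by
          rw [add_nsmul, add_nsmul, one_nsmul]; abel
      _ = φ b • (s + g b) := by rw [← hd, nsmul_add]
      _ = 0 + φ a • g b := by rw [h, zero_add, ← map_nsmul, ← map_nsmul, hab]
  have hb : b = 0 := (map_eq_zero_iff g hg).mp (hpos _ _ (hcancel _ _ _ hsum))
  simp [hb] at hlt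


/-- Let `S` embed into `ℕ` and let `f : S →+ M₁`, `g : S →+ M₂` be injective homomorphisms
into positive cancellative additive commutative monoids.  If `s₁ + f a = f b` and
`s₂ + g b = g a`, then `s₁ = 0` and `s₂ = 0`. -/
theorem fiberedSum_zero_class
    {S M₁ M₂ : Type*} [AddCommMonoid S] [AddCommMonoid M₁] [AddCommMonoid M₂]
    (φ : S →+ ℕ) (hφ : Function.Injective φ)
    (f : S →+ M₁) (hf : Function.Injective f)
    (g : S →+ M₂) (hg : Function.Injective g)
    (hcancel₁ : ∀ x y z : M₁, x + z = y + z → x = y)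
    (hcancel₂ : ∀ x y z : M₂, x + z = y + z → x = y)
    (hpos₁ : ∀ x y : M₁, x + y = 0 → x = 0)
    (hpos₂ : ∀ x y : M₂, x + y = 0 → x = 0)
    (s₁ : M₁) (s₂ : M₂) (a b : S)
    (h₁ : s₁ + f a = f b) (h₂ : s₂ + g b = g a) :
    s₁ = 0 ∧ s₂ = 0 := by
  obtain rfl : a = b := hφ <| le_antisymm
    (map_le_map_of_add_map_eq φ hφ f hf hcancel₁ hpos₁ h₁)
    (map_le_map_of_add_map_eq φ hφ g hg hcancel₂ hpos₂ h₂)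
  exact ⟨hcancel₁ _ _ (f a) (by rw [h₁, zero_add]), hcancel₂ _ _ (g a) (by rw [h₂, zero_add])⟩
end

section
/- Let S be an additive commutative monoid and let f : S → M₁ and g : S → M₂ be injective additive monoid homomorphisms into positive cancellative additive commutative monoids M₁ and M₂. Assume that every element x ∈ M₂ can be written as x = g(c) + w with c ∈ S and w ∈ M₂ Apéry over the image g(S), and that such expressions are unique: if g(c₁) + w₁ = g(c₂) + w₂ with w₁, w₂ Apéry over g(S), then c₁ = c₂ and w₁ = w₂. If s₁, t₁ ∈ M₁, s₂, t₂ ∈ M₂ and a, b ∈ S satisfy s₁ + t₁ + f(a) = f(b) in M₁ and s₂ + t₂ + g(b) = g(a) in M₂, then s₁ = t₁ = 0 and s₂ = t₂ = 0. -/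
/-- `w` is Apéry over the image of `g : S →+ M`: `w` cannot be written as `g c + w'` with
`g c ≠ 0`. -/
def AperyOverImage {S M : Type*} [AddCommMonoid S] [AddCommMonoid M]
    (g : S →+ M) (w : M) : Prop :=
  ¬ ∃ c : S, g c ≠ 0 ∧ ∃ w' : M, w = g c + w'

theorem AperyOverImage.zero {S M : Type*} [AddCommMonoid S] [AddCommMonoid M] (g : S →+ M)
    (hpos : ∀ x y : M, x + y = 0 → x = 0) : AperyOverImage g 0 := by
  rintro ⟨c, hc, w, hw⟩
  exact hc (hpos _ _ hw.symm)

/-- Let `f : S →+ M₁` and `g : S →+ M₂` be injective homomorphisms into positive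
cancellative additive commutative monoids, and assume every element of `M₂` has a unique
representation over `g(S)`.  If `s₁ + t₁ + f a = f b` and `s₂ + t₂ + g b = g a`, then
`s₁ = t₁ = 0` and `s₂ = t₂ = 0` (positivity of the fibered sum under unique
representations). -/
theorem fiberedSum_positive_of_uniqueRep
    {S M₁ M₂ : Type*} [AddCommMonoid S] [AddCommMonoid M₁] [AddCommMonoid M₂]
    (f : S →+ M₁) (hf : Function.Injective f)
    (g : S →+ M₂) (hg : Function.Injective g)
    (hcancel₁ : ∀ x y z : M₁, x + z = y + z → x = y)
    (hcancel₂ : ∀ x y z : M₂, x + z = y + z → x = y)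
    (hpos₁ : ∀ x y : M₁, x + y = 0 → x = 0)
    (hpos₂ : ∀ x y : M₂, x + y = 0 → x = 0)
    (hrep : ∀ x : M₂, ∃ (c : S) (w : M₂), AperyOverImage g w ∧ x = g c + w)
    (huniq : ∀ (c₁ c₂ : S) (w₁ w₂ : M₂), AperyOverImage g w₁ → AperyOverImage g w₂ →
      g c₁ + w₁ = g c₂ + w₂ → c₁ = c₂ ∧ w₁ = w₂)
    (s₁ t₁ : M₁) (s₂ t₂ : M₂) (a b : S)
    (h₁ : s₁ + t₁ + f a = f b) (h₂ : s₂ + t₂ + g b = g a) :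
    s₁ = 0 ∧ t₁ = 0 ∧ s₂ = 0 ∧ t₂ = 0 := by
  obtain ⟨c, w, hw, hx⟩ := hrep (s₂ + t₂)
  obtain ⟨rfl, rfl⟩ := huniq (c + b) a w 0 hw (.zero g hpos₂) (by
    rw [add_zero, ← h₂, hx, map_add, add_right_comm])
  have h_sum : s₁ + (t₁ + f c) = 0 := by
    apply hcancel₁ _ _ (f b)
    rw [zero_add, ← add_assoc, add_assoc, ← map_add, h₁]
  have hs₁ : s₁ = 0 := hpos₁ _ _ h_sum
  have h_rest : t₁ + f c = 0 := by rwa [hs₁, zero_add] at h_sum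
  have ht₁ : t₁ = 0 := hpos₁ _ _ h_rest
  have hc : c = 0 := hf (by rwa [ht₁, zero_add, ← map_zero f] at h_rest)
  have hx₀ : s₂ + t₂ = 0 := by rw [hx, hc, map_zero, add_zero]
  exact ⟨hs₁, ht₁, hpos₂ _ _ hx₀, hpos₂ _ _ (by rwa [add_comm])⟩
end

section
/- Let κ be a field, d a positive integer, and S ⊆ S' finitely generated additive submonoids of ℤ^d with S' positive (i.e., 0 is the only element of S' whose negative also lies in S'). Then the following are equivalent: (i) every element of S' has a unique representation over S; (ii) the monoid algebra AddMonoidAlgebra κ S' is a free module over AddMonoidAlgebra κ S; (iii) AddMonoidAlgebra κ S' is a flat module over AddMonoidAlgebra κ S. -/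
/-- Every element of `S'` has a unique representation over `S`: every `x ∈ S'` can be
written as `t + w` with `t ∈ S` and `w` Apéry over `S`, and such expressions are unique. -/
def UniqueRep {M : Type*} [AddCommMonoid M] (S' S : AddSubmonoid M) : Prop :=
  (∀ x ∈ S', ∃ t ∈ S, ∃ w, IsApery S' S w ∧ x = t + w) ∧
  (∀ t₁ ∈ S, ∀ t₂ ∈ S, ∀ w₁ w₂ : M, IsApery S' S w₁ → IsApery S' S w₂ →
    t₁ + w₁ = t₂ + w₂ → t₁ = t₂ ∧ w₁ = w₂)

section AperyRepresentations

variable {M : Type*} [AddCancelCommMonoid M] {S S' : AddSubmonoid M}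

/-- In a finitely generated positive monoid, passing to a proper summand is well-founded. -/
theorem AddSubmonoid.FG.wellFounded_proper_summand (hfg : S'.FG)
    (hpos : ∀ x ∈ S', ∀ y ∈ S', x + y = 0 → x = 0) :
    WellFounded fun a b : S' => ∃ t : S', t ≠ 0 ∧ b = t + a := by
  let r : S' → S' → Prop := fun a b => ∃ t : S', b = t + a
  have : IsPreorder S' r :=
    { refl := fun a => ⟨0, by simp⟩
      trans := by
        rintro a b c ⟨t, rfl⟩ ⟨u, rfl⟩
        exact ⟨u + t, by rw [add_assoc]⟩ }
  have hr : WellQuasiOrdered r := by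
    obtain ⟨n, f, hf⟩ := AddSubmonoid.fg_iff_exists_fin_addMonoidHom.1
      (AddMonoid.fg_def.1 ((AddMonoid.fg_iff_addSubmonoid_fg S').2 hfg))
    rw [AddMonoidHom.mrange_eq_top] at hf
    refine (wellQuasiOrdered_le (α := Fin n → ℕ)).of_surjective
      ⟨f, fun {a b} hab => ⟨f (b - a), ?_⟩⟩ hf
    rw [← map_add, tsub_add_cancel_of_le hab]
  refine hr.wellFounded.mono ?_
  rintro a b ⟨t, ht, rfl⟩
  refine ⟨⟨t, rfl⟩, ?_⟩
  rintro ⟨u, hu⟩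
  have hut : (t : M) + u = 0 := by
    have h : a + (u + t) = a + 0 := by rw [add_zero, add_comm, add_assoc]; exact hu.symm
    have := congrArg Subtype.val (add_left_cancel h)
    rw [add_comm]
    simpa using this
  exact ht (Subtype.ext (hpos t t.2 u u.2 hut))

/-- Every element of a finitely generated positive monoid `S'` has a representation over `S`. -/
theorem exists_apery_representation (hSS' : S ≤ S') (hfg : S'.FG)
    (hpos : ∀ x ∈ S', ∀ y ∈ S', x + y = 0 → x = 0) (x : M) (hx : x ∈ S') :
    ∃ t ∈ S, ∃ w, IsApery S' S w ∧ x = t + w := by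
  suffices ∀ x : S', ∃ t ∈ S, ∃ w, IsApery S' S w ∧ (x : M) = t + w from this ⟨x, hx⟩
  intro x
  induction x using (hfg.wellFounded_proper_summand hpos).induction with
  | _ x ih =>
    by_cases hA : IsApery S' S x
    · exact ⟨0, S.zero_mem, x, hA, by simp⟩
    · simp only [IsApery, x.2, true_and, not_not] at hA
      obtain ⟨t, ht, ht0, y, hy, hxy⟩ := hA
      obtain ⟨u, hu, w, hw, hyw⟩ := ih ⟨y, hy⟩
        ⟨⟨t, hSS' ht⟩, fun h => ht0 (congrArg Subtype.val h), Subtype.ext hxy⟩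
      refine ⟨t + u, S.add_mem ht hu, w, hw, ?_⟩
      rw [hxy, add_assoc]
      exact congrArg (t + ·) hyw

namespace AddMonoidAlgebra

variable {κ : Type*}

theorem exists_add_eq_of_coeff_mapDomain_mul_ne_zero {N P : Type*} [Semiring κ] [Add P]
    (f : N → P) (a : AddMonoidAlgebra κ N) (y : AddMonoidAlgebra κ P) (p : P)
    (h : (mapDomain f a * y).coeff p ≠ 0) :
    ∃ n q, a.coeff n ≠ 0 ∧ f n + q = p := by
  classical
  have hp := support_coeff_mul_subset _ _ (Finsupp.mem_support_iff.2 h)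
  obtain ⟨m, hm, q, -, hmq⟩ := Finset.mem_add.1 hp
  obtain ⟨n, hn, rfl⟩ := Finset.mem_image.1 (Finsupp.mapDomain_support hm)
  exact ⟨n, q, Finsupp.mem_support_iff.1 hn, hmq⟩

variable (κ)

/-- If representations over `S` are unique, the Apéry monomials form a basis of `κ[S']`. -/
theorem free_of_uniqueRep [Semiring κ] (hSS' : S ≤ S') (h : UniqueRep S' S) :
    letI : Module (AddMonoidAlgebra κ ↥S) (AddMonoidAlgebra κ ↥S') :=
      (AddMonoidAlgebra.mapDomainRingHom κ (AddSubmonoid.inclusion hSS')).toModule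
    Module.Free (AddMonoidAlgebra κ ↥S) (AddMonoidAlgebra κ ↥S') := by
  let : Module (AddMonoidAlgebra κ ↥S) (AddMonoidAlgebra κ ↥S') :=
    (AddMonoidAlgebra.mapDomainRingHom κ (AddSubmonoid.inclusion hSS')).toModule
  have smul_def (a : AddMonoidAlgebra κ S) (y : AddMonoidAlgebra κ S') :
    a • y = mapDomain (AddSubmonoid.inclusion hSS') a * y := rfl
  have hinj : Function.Injective (AddSubmonoid.inclusion hSS') :=
    AddSubmonoid.inclusion_injective hSS'
  let v : {w : S' // IsApery S' S (w : M)} → AddMonoidAlgebra κ S' := fun w => single w.1 1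
  have coeff_smul_v (l : AddMonoidAlgebra κ S) (s : S) (w : {w : S' // IsApery S' S (w : M)}) :
      (l • v w).coeff (AddSubmonoid.inclusion hSS' s + w) = l.coeff s := by
    rw [smul_def, coeff_mul_single_add, mul_one]
    exact Finsupp.mapDomain_apply hinj _ _
  refine Module.Free.of_basis (Module.Basis.mk (v := v) ?_ ?_)
  · have key (l : {w : S' // IsApery S' S (w : M)} →₀ AddMonoidAlgebra κ S)
        (w : {w : S' // IsApery S' S (w : M)}) (s : S) :
        (Finsupp.linearCombination _ v l).coeff (AddSubmonoid.inclusion hSS' s + w) =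
          (l w).coeff s := by
      rw [Finsupp.linearCombination_apply, coeff_finsuppSum, Finsupp.sum_apply,
        Finsupp.sum_eq_single w]
      · exact coeff_smul_v _ _ _
      · intro w' _ hw'
        classical
        by_contra hne
        refine hw' ?_
        rw [smul_def] at hne
        by_cases hex : ∃ d, d + w'.1 = AddSubmonoid.inclusion hSS' s + w
        · obtain ⟨d, hd⟩ := hex
          rw [← hd, coeff_mul_single_add, mul_one] at hne
          obtain ⟨s', -, rfl⟩ :=
            Finset.mem_image.1 (Finsupp.mapDomain_support (Finsupp.mem_support_iff.2 hne))
          exact Subtype.ext (Subtype.ext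
            (h.2 s' s'.2 s s.2 w' w w'.2 w.2 (congrArg Subtype.val hd)).2)
        · exact absurd (coeff_mul_single_of_forall_add_ne _ _ (fun d hd => hex ⟨d, hd⟩)) hne
      · intro _
        rw [smul_def, mapDomain_zero, zero_mul, coeff_zero, Finsupp.zero_apply]
    intro l l' hll
    ext w s
    rw [← key, ← key, hll]
  · rintro x -
    rw [← sum_coeff_single x]
    refine Submodule.sum_mem _ fun m _ => ?_
    obtain ⟨t, ht, w, hw, hm⟩ := h.1 m m.2
    have hsm : single m (x.coeff m) = single (⟨t, ht⟩ : S) (x.coeff m) • v ⟨⟨w, hw.1⟩, hw⟩ := by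
      rw [smul_def, mapDomain_single, single_mul_single, mul_one]
      congr 1
      exact Subtype.ext hm
    rw [hsm]
    exact Submodule.smul_mem _ _ (Submodule.subset_span ⟨_, rfl⟩)

variable {κ}

theorem exists_eq_add_of_flat [CommRing κ] [Nontrivial κ] (hSS' : S ≤ S')
    (h : letI : Module (AddMonoidAlgebra κ ↥S) (AddMonoidAlgebra κ ↥S') :=
        (AddMonoidAlgebra.mapDomainRingHom κ (AddSubmonoid.inclusion hSS')).toModule
      Module.Flat (AddMonoidAlgebra κ ↥S) (AddMonoidAlgebra κ ↥S'))
    {t₁ t₂ w₁ w₂ : M} (ht₁ : t₁ ∈ S) (ht₂ : t₂ ∈ S) (hw₁ : IsApery S' S w₁) (hw₂ : w₂ ∈ S')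
    (heq : t₁ + w₁ = t₂ + w₂) : ∃ u ∈ S, t₁ = t₂ + u := by
  let : Module (AddMonoidAlgebra κ ↥S) (AddMonoidAlgebra κ ↥S') :=
    (AddMonoidAlgebra.mapDomainRingHom κ (AddSubmonoid.inclusion hSS')).toModule
  have smul_def (a : AddMonoidAlgebra κ S) (y : AddMonoidAlgebra κ S') :
    a • y = mapDomain (AddSubmonoid.inclusion hSS') a * y := rfl
  let T₁ : S := ⟨t₁, ht₁⟩
  let T₂ : S := ⟨t₂, ht₂⟩
  let W₁ : S' := ⟨w₁, hw₁.1⟩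
  let W₂ : S' := ⟨w₂, hw₂⟩
  have hrel : ∑ i, (![single T₁ 1, -single T₂ 1] : Fin 2 → AddMonoidAlgebra κ S) i •
      (![single W₁ 1, single W₂ 1] : Fin 2 → AddMonoidAlgebra κ S') i = 0 := by
    have hTW : AddSubmonoid.inclusion hSS' T₁ + W₁ = AddSubmonoid.inclusion hSS' T₂ + W₂ :=
      Subtype.ext heq
    have hneg := map_neg (mapDomainRingHom κ (AddSubmonoid.inclusion hSS')) (single T₂ 1)
    simp only [mapDomainRingHom_apply] at hneg
    simp [Fin.sum_univ_two, smul_def, hTW, hneg]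
  obtain ⟨k, a, y, hx, hf⟩ := h.isTrivialRelation_of_sum_smul_eq_zero hrel
  obtain ⟨j, hj⟩ : ∃ j, (a 0 j • y j).coeff W₁ ≠ 0 := by
    by_contra! hzero
    have h1 := congrArg (fun z => z.coeff W₁) (hx 0)
    simp [coeff_sum, Finsupp.finsetSum_apply, hzero] at h1
  obtain ⟨s, q, hs, hsq⟩ := exists_add_eq_of_coeff_mapDomain_mul_ne_zero _ _ _ _ hj
  have hs0 : s = 0 := by
    by_contra hne
    exact hw₁.2 ⟨s, s.2, fun h0 => hne (Subtype.ext h0), q, q.2, (congrArg Subtype.val hsq).symm⟩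
  subst hs0
  have hfj : single T₁ 1 * a 0 j = single T₂ 1 * a 1 j := by
    have := hf j
    simp only [Fin.sum_univ_two, Matrix.cons_val_zero, Matrix.cons_val_one, neg_mul] at this
    exact add_neg_eq_zero.1 this
  have hcoeff : (single T₂ 1 * a 1 j).coeff (T₁ + 0) ≠ 0 := by
    rw [← hfj, coeff_single_mul_add, one_mul]
    exact hs
  by_contra! hno
  refine hcoeff (coeff_single_mul_of_forall_add_ne _ _ fun d hd => hno d d.2 ?_)
  simpa [T₁, T₂] using (congrArg Subtype.val hd).symm

/-- Flatness of `κ[S']` over `κ[S]` forces unique representations over `S`. -/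
theorem uniqueRep_of_flat [CommRing κ] [Nontrivial κ] (hSS' : S ≤ S') (hfg : S'.FG)
    (hpos : ∀ x ∈ S', ∀ y ∈ S', x + y = 0 → x = 0)
    (h : letI : Module (AddMonoidAlgebra κ ↥S) (AddMonoidAlgebra κ ↥S') :=
        (AddMonoidAlgebra.mapDomainRingHom κ (AddSubmonoid.inclusion hSS')).toModule
      Module.Flat (AddMonoidAlgebra κ ↥S) (AddMonoidAlgebra κ ↥S')) :
    UniqueRep S' S := by
  refine ⟨exists_apery_representation hSS' hfg hpos, ?_⟩
  intro t₁ ht₁ t₂ ht₂ w₁ w₂ hw₁ hw₂ heq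
  obtain ⟨u, hu, rfl⟩ := exists_eq_add_of_flat hSS' h ht₁ ht₂ hw₁ hw₂.1 heq
  obtain ⟨u', hu', h2⟩ := exists_eq_add_of_flat hSS' h ht₂ ht₁ hw₂ hw₁.1 heq.symm
  have huu : u + u' = 0 := by
    rw [add_assoc] at h2
    exact left_eq_add.1 h2
  obtain rfl := hpos u (hSS' hu) u' (hSS' hu') huu
  rw [add_zero] at heq ⊢
  exact ⟨rfl, add_left_cancel heq⟩

end AddMonoidAlgebra

end AperyRepresentations

/-- For finitely generated submonoids `S ⊆ S'` of `ℤ^d` with `S'` positive, the monoid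
algebra `κ[S']` is free over `κ[S]` iff it is flat over `κ[S]` iff every element of `S'`
has a unique representation over `S`. -/
theorem free_iff_flat_iff_uniqueRep
    (κ : Type*) [Field κ] (d : ℕ) (hd : 0 < d)
    (S S' : AddSubmonoid (Fin d → ℤ)) (hSS' : S ≤ S')
    (hfg : S.FG) (hfg' : S'.FG)
    (hpos : ∀ x ∈ S', -x ∈ S' → x = 0) :
    letI : Module (AddMonoidAlgebra κ ↥S) (AddMonoidAlgebra κ ↥S') :=
      (AddMonoidAlgebra.mapDomainRingHom κ (AddSubmonoid.inclusion hSS')).toModule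
    (UniqueRep S' S ↔ Module.Free (AddMonoidAlgebra κ ↥S) (AddMonoidAlgebra κ ↥S')) ∧
    (UniqueRep S' S ↔ Module.Flat (AddMonoidAlgebra κ ↥S) (AddMonoidAlgebra κ ↥S')) := by
  have hpos' : ∀ x ∈ S', ∀ y ∈ S', x + y = 0 → x = 0 := fun x hx y hy hxy =>
    hpos x hx (by rwa [neg_eq_of_add_eq_zero_right hxy])
  let : Module (AddMonoidAlgebra κ ↥S) (AddMonoidAlgebra κ ↥S') :=
    (AddMonoidAlgebra.mapDomainRingHom κ (AddSubmonoid.inclusion hSS')).toModule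
  have hfree : UniqueRep S' S → Module.Free (AddMonoidAlgebra κ ↥S) (AddMonoidAlgebra κ ↥S') :=
    AddMonoidAlgebra.free_of_uniqueRep κ hSS'
  have hflat : Module.Flat (AddMonoidAlgebra κ ↥S) (AddMonoidAlgebra κ ↥S') → UniqueRep S' S :=
    AddMonoidAlgebra.uniqueRep_of_flat hSS' hfg' hpos'
  exact ⟨⟨hfree, fun _ => hflat inferInstance⟩,
    ⟨fun h => have := hfree h; inferInstance, hflat⟩⟩
end

section
/- Let κ be a field, d a positive integer, and S ⊆ S' additive submonoids of ℤ^d. If AddMonoidAlgebra κ S' is a flat module over AddMonoidAlgebra κ S, then representations over S are unique: whenever s₁ + w₁ = s₂ + w₂ with s₁, s₂ ∈ S and w₁, w₂ ∈ S' Apéry over S, one has s₁ = s₂ and w₁ = w₂. -/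
/-- If `w` lies in the support of `∑ j, φ (a j) * y j` and `w` is Apéry, then some `a j` has
nonzero constant coefficient. -/
theorem exists_coeff_zero_ne_zero_of_isApery {κ M ι : Type*} [Semiring κ] [AddCommMonoid M]
    [Fintype ι] {S S' : AddSubmonoid M} (hSS' : S ≤ S') {w : M} (hw : IsApery S' S w)
    (a : ι → AddMonoidAlgebra κ S) (y : ι → AddMonoidAlgebra κ S')
    (h : (∑ j, AddMonoidAlgebra.mapDomainRingHom κ (AddSubmonoid.inclusion hSS') (a j) *
      y j).coeff ⟨w, hw.1⟩ ≠ 0) :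
    ∃ j, (a j).coeff 0 ≠ 0 := by
  classical
  rw [AddMonoidAlgebra.coeff_sum, Finsupp.finsetSum_apply] at h
  obtain ⟨j, -, hj⟩ := Finset.exists_ne_zero_of_sum_ne_zero h
  obtain ⟨p, hp, q, -, hpq⟩ := Finset.mem_add.1
    (AddMonoidAlgebra.support_coeff_mul_subset _ _ (Finsupp.mem_support_iff.2 hj))
  obtain ⟨s, hs, rfl⟩ := Finset.mem_image.1 (Finsupp.mapDomain_support hp)
  have hs0 : s = 0 := by
    by_contra hne
    exact hw.2 ⟨s, s.2, fun h0 => hne (Subtype.ext h0), q, q.2, (congrArg Subtype.val hpq).symm⟩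
  exact ⟨j, hs0 ▸ Finsupp.mem_support_iff.1 hs⟩

/-- If `κ[S']` is flat over `κ[S]` for submonoids `S ⊆ S'` of `ℤ^d`, then representations
over `S` are unique. -/
theorem uniqueRep_of_flat
    (κ : Type*) [Field κ] (d : ℕ) (hd : 0 < d)
    (S S' : AddSubmonoid (Fin d → ℤ)) (hSS' : S ≤ S') :
    letI : Module (AddMonoidAlgebra κ ↥S) (AddMonoidAlgebra κ ↥S') :=
      (AddMonoidAlgebra.mapDomainRingHom κ (AddSubmonoid.inclusion hSS')).toModule
    Module.Flat (AddMonoidAlgebra κ ↥S) (AddMonoidAlgebra κ ↥S') →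
      ∀ t₁ ∈ S, ∀ t₂ ∈ S, ∀ w₁ w₂ : Fin d → ℤ, IsApery S' S w₁ → IsApery S' S w₂ →
        t₁ + w₁ = t₂ + w₂ → t₁ = t₂ ∧ w₁ = w₂ := by
  classical
  intro hflat t₁ ht₁ t₂ ht₂ w₁ w₂ hw₁ hw₂ heq
  let _ : Module (AddMonoidAlgebra κ S) (AddMonoidAlgebra κ S') :=
    (AddMonoidAlgebra.mapDomainRingHom κ (AddSubmonoid.inclusion hSS')).toModule
  suffices t₁ = t₂ from ⟨this, by rwa [this, add_right_inj] at heq⟩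
  by_contra hne
  have hrel : ∑ i, ![AddMonoidAlgebra.single (⟨t₁, ht₁⟩ : S) (1 : κ),
      -AddMonoidAlgebra.single (⟨t₂, ht₂⟩ : S) (1 : κ)] i •
      ![AddMonoidAlgebra.single (⟨w₁, hw₁.1⟩ : S') (1 : κ),
        AddMonoidAlgebra.single (⟨w₂, hw₂.1⟩ : S') (1 : κ)] i = 0 := by
    simp only [Fin.sum_univ_two, Matrix.cons_val_zero, Matrix.cons_val_one, neg_smul,
      ← sub_eq_add_neg, sub_eq_zero]
    change AddMonoidAlgebra.mapDomainRingHom κ (AddSubmonoid.inclusion hSS') _ * _ =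
      AddMonoidAlgebra.mapDomainRingHom κ (AddSubmonoid.inclusion hSS') _ * _
    simp only [AddMonoidAlgebra.mapDomainRingHom_apply, AddMonoidAlgebra.mapDomain_single,
      AddMonoidAlgebra.single_mul_single]
    congr 1
    exact Subtype.ext heq
  obtain ⟨k, a, y, hx, ha⟩ := Module.Flat.isTrivialRelation_of_sum_smul_eq_zero hrel
  obtain ⟨j, hj⟩ := exists_coeff_zero_ne_zero_of_isApery hSS' hw₁ (a 0) y (by
    have h := hx 0
    change AddMonoidAlgebra.single (⟨w₁, hw₁.1⟩ : S') (1 : κ) = ∑ j,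
      AddMonoidAlgebra.mapDomainRingHom κ (AddSubmonoid.inclusion hSS') (a 0 j) * y j at h
    rw [← h, AddMonoidAlgebra.coeff_single, Finsupp.single_eq_same]
    exact one_ne_zero)
  have h := ha j
  simp only [Fin.sum_univ_two, Matrix.cons_val_zero, Matrix.cons_val_one, neg_mul,
    ← sub_eq_add_neg, sub_eq_zero] at h
  have hc : (AddMonoidAlgebra.single (⟨t₁, ht₁⟩ : S) (1 : κ) * a 0 j).coeff ⟨t₁, ht₁⟩ ≠ 0 := by
    rwa [AddMonoidAlgebra.coeff_single_mul_eq_mul_coeff (m₂ := 0) (by simp), one_mul]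
  rw [h] at hc
  obtain ⟨s, -, hs⟩ := Finset.mem_image.1
    (AddMonoidAlgebra.support_coeff_single_mul_subset _ _ _ (Finsupp.mem_support_iff.2 hc))
  have hs : t₂ + s = t₁ := congrArg Subtype.val hs
  refine hw₂.2 ⟨s, s.2, fun h0 => hne (by rw [← hs, h0, add_zero]), w₁, hw₁.1, ?_⟩
  rw [← hs, add_assoc, add_right_inj] at heq
  exact heq.symm
end

section
/- Let κ be a field, d a positive integer, S' an additive submonoid of ℕ^d, and s ∈ S'. Let S be the submonoid of S' generated by s, i.e., S = {n•s : n ∈ ℕ}. Then AddMonoidAlgebra κ S' is a flat (indeed free) module over AddMonoidAlgebra κ S. -/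
/-- If every element of `B` is uniquely of the form `f a + t i`, then the monomials with exponents
`t i` form a basis of the monoid algebra `k[B]` over `k[A]`. -/
theorem AddMonoidAlgebra.free_of_bijective_add {k A B ι : Type*} [CommSemiring k] [AddCommMonoid A]
    [AddCommMonoid B] (f : A →+ B) (t : ι → B)
    (h : Function.Bijective fun p : ι × A => f p.2 + t p.1) :
    letI : Module (AddMonoidAlgebra k A) (AddMonoidAlgebra k B) :=
      (AddMonoidAlgebra.mapDomainRingHom k f).toModule
    Module.Free (AddMonoidAlgebra k A) (AddMonoidAlgebra k B) := by
  let : Module (AddMonoidAlgebra k A) (AddMonoidAlgebra k B) :=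
    (AddMonoidAlgebra.mapDomainRingHom k f).toModule
  let E : (ι →₀ AddMonoidAlgebra k A) ≃+ AddMonoidAlgebra k B :=
    (Finsupp.mapRange.addEquiv AddMonoidAlgebra.coeffAddEquiv).trans
      (Finsupp.curryAddEquiv.symm.trans
        ((Finsupp.domCongr (Equiv.ofBijective _ h)).trans AddMonoidAlgebra.coeffAddEquiv.symm))
  let L := Finsupp.linearCombination (AddMonoidAlgebra k A)
    fun i => (AddMonoidAlgebra.single (t i) 1 : AddMonoidAlgebra k B)
  have hLE : L.toAddMonoidHom = E.toAddMonoidHom := by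
    refine Finsupp.addHom_ext' fun i => AddMonoidAlgebra.addMonoidHom_ext fun a c => ?_
    have hL : L (Finsupp.single i (AddMonoidAlgebra.single a c)) =
        AddMonoidAlgebra.single (f a + t i) c := by
      rw [Finsupp.linearCombination_single]
      change AddMonoidAlgebra.mapDomain f _ * _ = _
      rw [AddMonoidAlgebra.mapDomain_single, AddMonoidAlgebra.single_mul_single, mul_one]
    have hE : E (Finsupp.single i (AddMonoidAlgebra.single a c)) =
        AddMonoidAlgebra.single (f a + t i) c := by
      ext
      simp [E, Finsupp.curryAddEquiv, Finsupp.curryEquiv]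
    exact hL.trans hE.symm
  have hL : Function.Bijective L := by
    have : ⇑L = E := funext fun x => DFunLike.congr_fun hLE x
    exact this ▸ E.bijective
  exact Module.Free.of_equiv (LinearEquiv.ofBijective L hL)

/-- Every element of a submonoid of `ℕ^d` containing `s` is uniquely the sum of a multiple of `s`
and an element from which `s` cannot be subtracted (any element, if `s = 0`). -/
theorem AddSubmonoid.bijective_closure_singleton_add {d : ℕ} (S' : AddSubmonoid (Fin d → ℕ))
    (s : Fin d → ℕ) (hs : s ∈ S') :
    Function.Bijective
      fun p : {t : S' // ∀ u ∈ S', s + u = (t : Fin d → ℕ) → s = 0} × AddSubmonoid.closure {s} =>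
        AddSubmonoid.inclusion
          (AddSubmonoid.closure_le.2 (Set.singleton_subset_iff.2 hs)) p.2 + (p.1 : S') := by
  have mem_smul_add {n m : ℕ} {t t' : Fin d → ℕ} (ht : t ∈ S')
      (ht' : ∀ u ∈ S', s + u = t' → s = 0) (h : m • s + t' = n • s + t) (hmn : m < n) : s = 0 := by
    obtain ⟨k, rfl⟩ := Nat.exists_eq_add_of_lt hmn
    refine ht' (k • s + t) (S'.add_mem (S'.nsmul_mem hs k) ht) ?_
    apply add_left_cancel (a := m • s)
    rw [h, add_nsmul, add_nsmul, one_nsmul]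
    abel
  constructor
  · rintro ⟨⟨⟨t, ht⟩, htm⟩, ⟨a, ha⟩⟩ ⟨⟨⟨t', ht'⟩, htm'⟩, ⟨a', ha'⟩⟩ h
    obtain ⟨n, rfl⟩ := AddSubmonoid.mem_closure_singleton.1 ha
    obtain ⟨m, rfl⟩ := AddSubmonoid.mem_closure_singleton.1 ha'
    have h : n • s + t = m • s + t' := congrArg Subtype.val h
    have hnm : n • s = m • s := by
      rcases lt_trichotomy n m with hlt | rfl | hlt
      · simp [mem_smul_add ht' htm h hlt]
      · rfl
      · simp [mem_smul_add ht htm' h.symm hlt]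
    have htt : t = t' := add_left_cancel (hnm ▸ h)
    simp [hnm, htt]
  · rintro ⟨x, hx⟩
    induction hN : ∑ i, x i using Nat.strong_induction_on generalizing x with
    | _ N ih =>
      by_cases hmin : ∀ u ∈ S', s + u = x → s = 0
      · exact ⟨⟨⟨⟨x, hx⟩, hmin⟩, 0⟩, by simp⟩
      · push Not at hmin
        obtain ⟨u, hu, rfl, hs0⟩ := hmin
        have hpos : 0 < ∑ i, s i := by
          obtain ⟨i, hi⟩ := Function.ne_iff.1 hs0
          exact Finset.sum_pos' (fun _ _ => Nat.zero_le _)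
            ⟨i, Finset.mem_univ i, Nat.pos_of_ne_zero hi⟩
        have hlt : ∑ i, u i < N := by
          simp only [← hN, Pi.add_apply, Finset.sum_add_distrib]
          lia
        obtain ⟨⟨t, a⟩, h⟩ := ih _ hlt u hu rfl
        refine ⟨⟨t, ⟨s, AddSubmonoid.subset_closure rfl⟩ + a⟩, Subtype.ext ?_⟩
        have h : (a : Fin d → ℕ) + (t : S') = u := congrArg Subtype.val h
        change s + (a : Fin d → ℕ) + (t : S') = s + u
        rw [add_assoc, h]


/-- For a submonoid `S'` of `ℕ^d`, an element `s ∈ S'` and the submonoid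
`S = {n • s : n ∈ ℕ}` generated by `s`, the monoid algebra `κ[S']` is a flat, indeed
free, module over `κ[S]`. -/
theorem flat_free_over_singleton
    (κ : Type*) [Field κ] (d : ℕ) (hd : 0 < d)
    (S' : AddSubmonoid (Fin d → ℕ)) (s : Fin d → ℕ) (hs : s ∈ S') :
    letI : Module (AddMonoidAlgebra κ ↥(AddSubmonoid.closure {s})) (AddMonoidAlgebra κ ↥S') :=
      (AddMonoidAlgebra.mapDomainRingHom κ (AddSubmonoid.inclusion
        (AddSubmonoid.closure_le.2 (Set.singleton_subset_iff.2 hs)))).toModule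
    Module.Flat (AddMonoidAlgebra κ ↥(AddSubmonoid.closure {s})) (AddMonoidAlgebra κ ↥S') ∧
    Module.Free (AddMonoidAlgebra κ ↥(AddSubmonoid.closure {s})) (AddMonoidAlgebra κ ↥S') := by
  have hfree := AddMonoidAlgebra.free_of_bijective_add (k := κ) _ _
    (S'.bijective_closure_singleton_add s hs)
  exact ⟨@Module.Flat.of_free _ _ _ _ (_) hfree, hfree⟩
end

section
/- Let κ be a field and d, n, m positive integers. Let s₁, …, sₙ and t₁, …, tₘ be elements of ℕ^d, let S₁ and S₂ be the submonoids of ℕ^d generated by the sᵢ and the tⱼ respectively, and consider the κ-algebra homomorphisms φ₁ : κ[X₁, …, Xₙ] → AddMonoidAlgebra κ (ℕ^d), φ₂ : κ[Y₁, …, Yₘ] → AddMonoidAlgebra κ (ℕ^d), and φ : κ[X₁, …, Xₙ, Y₁, …, Yₘ] → AddMonoidAlgebra κ (ℕ^d) determined by φ(Xᵢ) = φ₁(Xᵢ) = u^{sᵢ} and φ(Yⱼ) = φ₂(Yⱼ) = u^{tⱼ}. Let i₁, …, iₙ, j₁, …, jₘ ∈ ℕ be such that w := i₁s₁ + ⋯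 + iₙsₙ = j₁t₁ + ⋯ + jₘtₘ is a nonzero element of S₁ ∩ S₂. Then the following are equivalent: (i) ker φ equals the ideal generated by the image of ker φ₁, the image of ker φ₂, and the single binomial X₁^{i₁}⋯Xₙ^{iₙ} − Y₁^{j₁}⋯Yₘ^{jₘ} (kernels of φ₁ and φ₂ being transported to κ[X₁, …, Xₙ, Y₁, …, Yₘ] along the canonical inclusions of polynomial rings); (ii) gp(S₁) ⊓ gp(S₂) = gp({w}) as subgroups of ℤ^d. -/
open MvPolynomial

/-- The coordinatewise inclusion `ℕ^d →+ ℤ^d`. -/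
def natToInt (d : ℕ) : (Fin d → ℕ) →+ (Fin d → ℤ) where
  toFun v := fun k => (v k : ℤ)
  map_zero' := by funext k; simp
  map_add' x y := by funext k; simp

/-- The `κ`-algebra homomorphism `κ[σ] → κ[M]` sending `X k` to `u ^ (v k)`. -/
noncomputable abbrev monomialHom (κ : Type*) [Field κ] {σ M : Type*} [AddCommMonoid M]
    (v : σ → M) : MvPolynomial σ κ →ₐ[κ] AddMonoidAlgebra κ M :=
  aeval fun k => AddMonoidAlgebra.single (v k) 1

section MonomialHom

variable {κ : Type*} [Field κ] {σ τ M N : Type*} [AddCommMonoid M] [AddCommMonoid N]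

theorem monomialHom_monomial (v : σ → M) (c : σ →₀ ℕ) (r : κ) :
    monomialHom κ v (monomial c r) = AddMonoidAlgebra.single (Finsupp.weight v c) r := by
  induction c using Finsupp.induction_linear generalizing r with
  | zero => simp [← C_apply]
  | add a b ha hb =>
    have : monomial (a + b) r = monomial a r * monomial b (1 : κ) := by simp [monomial_mul]
    rw [this, map_mul, ha, hb, AddMonoidAlgebra.single_mul_single, map_add, mul_one]
  | single k e =>
    simp [aeval_monomial, AddMonoidAlgebra.single_pow, Finsupp.weight_single,
      AddMonoidAlgebra.single_mul_single]

theorem monomial_sub_monomial_mem_ker (v : σ → M) {c c' : σ →₀ ℕ} :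
    monomial c (1 : κ) - monomial c' 1 ∈ RingHom.ker (monomialHom κ v) ↔
      Finsupp.weight v c = Finsupp.weight v c' := by
  rw [RingHom.mem_ker, map_sub, monomialHom_monomial, monomialHom_monomial, sub_eq_zero,
    AddMonoidAlgebra.single_left_inj one_ne_zero]

/-- The kernel of a monomial homomorphism is generated by binomials. -/
theorem ker_monomialHom_le (v : σ → M) (I : Ideal (MvPolynomial σ κ))
    (h : ∀ c c', Finsupp.weight v c = Finsupp.weight v c' →
      monomial c (1 : κ) - monomial c' 1 ∈ I) :
    RingHom.ker (monomialHom κ v) ≤ I := by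
  let L : AddMonoidAlgebra κ M →ₗ[κ] MvPolynomial σ κ ⧸ I :=
    (Finsupp.linearCombination κ fun x =>
      Ideal.Quotient.mkₐ κ I (monomial (Function.invFun (Finsupp.weight v) x) 1)) ∘ₗ
      (AddMonoidAlgebra.coeffLinearEquiv κ).toLinearMap
  have hL : L ∘ₗ (monomialHom κ v).toLinearMap = (Ideal.Quotient.mkₐ κ I).toLinearMap := by
    refine (basisMonomials σ κ).ext fun c => ?_
    have hc : Finsupp.weight v (Function.invFun (Finsupp.weight v) (Finsupp.weight v c)) =
        Finsupp.weight v c := Function.invFun_eq ⟨c, rfl⟩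
    have := Ideal.Quotient.eq.2 (h _ _ hc)
    simpa [L, monomialHom_monomial] using this
  intro f hf
  rw [RingHom.mem_ker] at hf
  have := LinearMap.congr_fun hL f
  simp only [LinearMap.comp_apply, AlgHom.toLinearMap_apply, hf, map_zero] at this
  exact Ideal.Quotient.eq_zero_iff_mem.1 this.symm

theorem weight_comp (v : σ → M) (g : M →+ N) (c : σ →₀ ℕ) :
    Finsupp.weight (g ∘ v) c = g (Finsupp.weight v c) := by
  simp [Finsupp.weight_apply, Finsupp.sum, map_sum, map_nsmul]

theorem ker_monomialHom_le_comp (v : σ → M) (g : M →+ N) :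
    RingHom.ker (monomialHom κ v) ≤ RingHom.ker (monomialHom κ (g ∘ v)) :=
  ker_monomialHom_le v _ fun c c' h => by
    rw [monomial_sub_monomial_mem_ker]
    rw [weight_comp, weight_comp, h]

theorem ker_monomialHom_comp (v : τ → M) (e : σ → τ) :
    RingHom.ker (monomialHom κ (v ∘ e)) =
      (RingHom.ker (monomialHom κ v)).comap (rename e : MvPolynomial σ κ →ₐ[κ] _) := by
  ext f
  simp only [Ideal.mem_comap, RingHom.mem_ker, aeval_rename]
  rfl

theorem weight_mapDomain (v : τ → M) (e : σ → τ) (c : σ →₀ ℕ) :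
    Finsupp.weight v (c.mapDomain e) = Finsupp.weight (v ∘ e) c := by
  rw [Finsupp.weight_apply, Finsupp.weight_apply, Finsupp.sum_mapDomain_index (by simp)
    (by simp [add_smul])]
  rfl

theorem weight_sumElim (v : σ → M) (v' : τ → M) (a : σ →₀ ℕ) (b : τ →₀ ℕ) :
    Finsupp.weight (Sum.elim v v') (a.mapDomain Sum.inl + b.mapDomain Sum.inr) =
      Finsupp.weight v a + Finsupp.weight v' b := by
  rw [map_add, weight_mapDomain, weight_mapDomain, Sum.elim_comp_inl, Sum.elim_comp_inr]

theorem exists_eq_mapDomain_inl_add_mapDomain_inr (c : σ ⊕ τ →₀ ℕ) :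
    ∃ (a : σ →₀ ℕ) (b : τ →₀ ℕ), c = a.mapDomain Sum.inl + b.mapDomain Sum.inr := by
  refine ⟨(Finsupp.sumFinsuppEquivProdFinsupp c).1, (Finsupp.sumFinsuppEquivProdFinsupp c).2, ?_⟩
  ext (x | x)
  · rw [Finsupp.add_apply, Finsupp.mapDomain_apply Sum.inl_injective,
      Finsupp.mapDomain_of_notMem_range _ _ (by simp)]
    simp
  · rw [Finsupp.add_apply, Finsupp.mapDomain_apply Sum.inr_injective,
      Finsupp.mapDomain_of_notMem_range _ _ (by simp)]
    simp

theorem rename_monomial_equivFunOnFinite_symm [Fintype σ] (e : σ → τ) (i : σ → ℕ) :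
    rename e (monomial (Finsupp.equivFunOnFinite.symm i) (1 : κ)) = ∏ k, X (e k) ^ i k := by
  simp [monomial_eq, Finsupp.prod_fintype]

theorem monomial_mapDomain_add_mapDomain (a : σ →₀ ℕ) (b : τ →₀ ℕ) :
    (monomial (a.mapDomain Sum.inl + b.mapDomain Sum.inr) 1 : MvPolynomial (σ ⊕ τ) κ) =
      rename Sum.inl (monomial a 1) * rename Sum.inr (monomial b 1) := by
  simp [rename_monomial, monomial_mul]

theorem monomial_add_nsmul (a b : σ →₀ ℕ) (k : ℕ) :
    (monomial (a + k • b) 1 : MvPolynomial σ κ) = monomial a 1 * monomial b 1 ^ k := by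
  simp [monomial_pow, monomial_mul]

theorem weight_equivFunOnFinite_symm [Fintype σ] (v : σ → M) (i : σ → ℕ) :
    Finsupp.weight v (Finsupp.equivFunOnFinite.symm i) = ∑ k, i k • v k := by
  simp [Finsupp.weight_eq_sum]

/-- An ideal containing both kernels and the gluing binomial contains every binomial whose two
sides differ by a multiple of `w`. -/
theorem binomial_mem_of_weight_eq_add_nsmul (v : σ → M) (v' : τ → M) (w : M)
    (i : σ →₀ ℕ) (j : τ →₀ ℕ) (hi : Finsupp.weight v i = w) (hj : Finsupp.weight v' j = w)
    (I : Ideal (MvPolynomial (σ ⊕ τ) κ))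
    (h₁ : ∀ f ∈ RingHom.ker (monomialHom κ v), rename Sum.inl f ∈ I)
    (h₂ : ∀ f ∈ RingHom.ker (monomialHom κ v'), rename Sum.inr f ∈ I)
    (h₃ : rename Sum.inl (monomial i (1 : κ)) - rename Sum.inr (monomial j 1) ∈ I)
    (k : ℕ) {a a' : σ →₀ ℕ} {b b' : τ →₀ ℕ}
    (ha : Finsupp.weight v a = Finsupp.weight v a' + k • w)
    (hb : Finsupp.weight v' b' = Finsupp.weight v' b + k • w) :
    (monomial (a.mapDomain Sum.inl + b.mapDomain Sum.inr) 1 : MvPolynomial (σ ⊕ τ) κ) -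
      monomial (a'.mapDomain Sum.inl + b'.mapDomain Sum.inr) 1 ∈ I := by
  have key₁ := h₁ _ ((monomial_sub_monomial_mem_ker (κ := κ) v (c := a) (c' := a' + k • i)).2
    (by rw [ha, map_add, map_nsmul, hi]))
  have key₂ := h₂ _ ((monomial_sub_monomial_mem_ker (κ := κ) v' (c := b') (c' := b + k • j)).2
    (by rw [hb, map_add, map_nsmul, hj]))
  rw [monomial_add_nsmul, map_sub, map_mul, map_pow, ← Ideal.Quotient.eq] at key₁
  rw [monomial_add_nsmul, map_sub, map_mul, map_pow, ← Ideal.Quotient.eq] at key₂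
  rw [← Ideal.Quotient.eq] at h₃ ⊢
  rw [monomial_mapDomain_add_mapDomain, monomial_mapDomain_add_mapDomain, map_mul, map_mul,
    key₁, key₂]
  simp only [map_mul, map_pow, h₃]
  ring

end MonomialHom

theorem mem_closure_natToInt_iff {d : ℕ} {σ : Type*} (s : σ → Fin d → ℕ) (x : Fin d → ℤ) :
    x ∈ AddSubgroup.closure
        (natToInt d '' (AddSubmonoid.closure (Set.range s) : Set (Fin d → ℕ))) ↔
      ∃ a a' : σ →₀ ℕ,
        x = natToInt d (Finsupp.weight s a) - natToInt d (Finsupp.weight s a') := by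
  have hmem : ∀ a : σ →₀ ℕ, Finsupp.weight s a ∈ AddSubmonoid.closure (Set.range s) := fun a => by
    rw [Finsupp.weight_apply]
    exact sum_mem fun k _ => nsmul_mem (AddSubmonoid.subset_closure (Set.mem_range_self k)) _
  constructor
  · intro hx
    induction hx using AddSubgroup.closure_induction with
    | mem x hx =>
      obtain ⟨y, hy, rfl⟩ := hx
      obtain ⟨a, rfl⟩ := AddSubmonoid.exists_finsupp_of_mem_closure_range _ _ hy
      exact ⟨a, 0, by simp [Finsupp.weight_apply]⟩
    | zero => exact ⟨0, 0, by simp⟩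
    | add x y _ _ hx hy =>
      obtain ⟨a, a', rfl⟩ := hx
      obtain ⟨b, b', rfl⟩ := hy
      exact ⟨a + b, a' + b', by simp only [map_add]; abel⟩
    | neg x _ hx =>
      obtain ⟨a, a', rfl⟩ := hx
      exact ⟨a', a, by abel⟩
  · rintro ⟨a, a', rfl⟩
    exact sub_mem (AddSubgroup.subset_closure ⟨_, hmem a, rfl⟩)
      (AddSubgroup.subset_closure ⟨_, hmem a', rfl⟩)

theorem natToInt_injective (d : ℕ) : Function.Injective (natToInt d) := fun x y h => by
  funext k
  exact Nat.cast_injective (R := ℤ) (congrFun h k)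

/-- Rosales' gluing condition.  Let `S₁` and `S₂` be the submonoids of `ℕ^d` generated by
`s₁, …, sₙ` and `t₁, …, tₘ`, let `φ₁ : κ[X₁,…,Xₙ] → κ[ℕ^d]`, `φ₂ : κ[Y₁,…,Yₘ] → κ[ℕ^d]`
and `φ : κ[X₁,…,Xₙ,Y₁,…,Yₘ] → κ[ℕ^d]` be given by `Xᵢ ↦ u^{sᵢ}`, `Yⱼ ↦ u^{tⱼ}`, and let
`w = i₁s₁ + ⋯ + iₙsₙ = j₁t₁ + ⋯ + jₘtₘ` be a nonzero element of `S₁ ∩ S₂`.  Then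
`ker φ = ker φ₁ + ker φ₂ + (X^i - Y^j)` if and only if
`gp(S₁) ⊓ gp(S₂) = gp({w})` inside `ℤ^d`. -/
theorem gluing_kernel_iff_gp
    (κ : Type*) [Field κ] (d n m : ℕ) (hd : 0 < d) (hn : 0 < n) (hm : 0 < m)
    (s : Fin n → (Fin d → ℕ)) (t : Fin m → (Fin d → ℕ))
    (i : Fin n → ℕ) (j : Fin m → ℕ)
    (hw : ∑ k, i k • s k = ∑ k, j k • t k)
    (hw0 : (∑ k, i k • s k) ≠ 0) :
    (RingHom.ker (MvPolynomial.aeval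
          (Sum.elim
            (fun k => (AddMonoidAlgebra.single (s k) 1 : AddMonoidAlgebra κ (Fin d → ℕ)))
            (fun k => (AddMonoidAlgebra.single (t k) 1 : AddMonoidAlgebra κ (Fin d → ℕ)))) :
          MvPolynomial (Fin n ⊕ Fin m) κ →ₐ[κ] AddMonoidAlgebra κ (Fin d → ℕ))
      = Ideal.span
          ((MvPolynomial.rename (Sum.inl : Fin n → Fin n ⊕ Fin m)) ''
              (RingHom.ker (MvPolynomial.aeval
                (fun k => (AddMonoidAlgebra.single (s k) 1 : AddMonoidAlgebra κ (Fin d → ℕ))) :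
                MvPolynomial (Fin n) κ →ₐ[κ] AddMonoidAlgebra κ (Fin d → ℕ)) : Set _)
            ∪ (MvPolynomial.rename (Sum.inr : Fin m → Fin n ⊕ Fin m)) ''
              (RingHom.ker (MvPolynomial.aeval
                (fun k => (AddMonoidAlgebra.single (t k) 1 : AddMonoidAlgebra κ (Fin d → ℕ))) :
                MvPolynomial (Fin m) κ →ₐ[κ] AddMonoidAlgebra κ (Fin d → ℕ)) : Set _)
            ∪ {(∏ k, MvPolynomial.X (Sum.inl k) ^ i k) -
                ∏ k, MvPolynomial.X (Sum.inr k) ^ j k}))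
    ↔ (AddSubgroup.closure (natToInt d '' (AddSubmonoid.closure (Set.range s) : Set (Fin d → ℕ)))
        ⊓ AddSubgroup.closure (natToInt d '' (AddSubmonoid.closure (Set.range t) : Set (Fin d → ℕ)))
        = AddSubgroup.closure {natToInt d (∑ k, i k • s k)}) := by
  have hφ : (fun k => (AddMonoidAlgebra.single (Sum.elim s t k) 1 :
      AddMonoidAlgebra κ (Fin d → ℕ))) =
      Sum.elim (fun k => AddMonoidAlgebra.single (s k) 1)
        (fun k => AddMonoidAlgebra.single (t k) 1) := by
    ext1 (k | k) <;> rfl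
  rw [← hφ, ← rename_monomial_equivFunOnFinite_symm Sum.inl i,
    ← rename_monomial_equivFunOnFinite_symm Sum.inr j, ← weight_equivFunOnFinite_symm s i]
  rw [← weight_equivFunOnFinite_symm s i, ← weight_equivFunOnFinite_symm t j] at hw
  generalize Finsupp.equivFunOnFinite.symm i = i at hw ⊢
  generalize Finsupp.equivFunOnFinite.symm j = j at hw ⊢
  constructor
  · intro h
    apply le_antisymm
    · rintro x ⟨hx₁, hx₂⟩
      obtain ⟨a, a', rfl⟩ := (mem_closure_natToInt_iff s x).1 hx₁
      obtain ⟨b', b, hb⟩ := (mem_closure_natToInt_iff t _).1 hx₂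
      let W := AddSubgroup.closure {natToInt d (Finsupp.weight s i)}
      let g : (Fin d → ℕ) →+ (Fin d → ℤ) ⧸ W := (QuotientAddGroup.mk' W).comp (natToInt d)
      let v : Fin n ⊕ Fin m → (Fin d → ℤ) ⧸ W :=
        Sum.elim (g ∘ s) ((0 : (Fin d → ℕ) →+ (Fin d → ℤ) ⧸ W) ∘ t)
      have hle : RingHom.ker (monomialHom κ (Sum.elim s t)) ≤ RingHom.ker (monomialHom κ v) := by
        refine h.le.trans (Ideal.span_le.2 ?_)
        rintro _ ((⟨f, hf, rfl⟩ | ⟨f, hf, rfl⟩) | rfl)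
        · exact (ker_monomialHom_comp v Sum.inl).le (ker_monomialHom_le_comp s g hf)
        · exact (ker_monomialHom_comp v Sum.inr).le (ker_monomialHom_le_comp t 0 hf)
        · rw [rename_monomial, rename_monomial, SetLike.mem_coe, monomial_sub_monomial_mem_ker,
            weight_mapDomain, weight_mapDomain, Sum.elim_comp_inl, Sum.elim_comp_inr,
            weight_comp, weight_comp]
          exact (QuotientAddGroup.eq_zero_iff _).2 (AddSubgroup.subset_closure rfl)
      have hmem := hle ((monomial_sub_monomial_mem_ker (κ := κ) (Sum.elim s t)
        (c := a.mapDomain Sum.inl + b.mapDomain Sum.inr)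
        (c' := a'.mapDomain Sum.inl + b'.mapDomain Sum.inr)).2 (by
          rw [weight_sumElim, weight_sumElim]
          apply natToInt_injective
          rw [map_add, map_add]
          rw [sub_eq_sub_iff_add_eq_add] at hb
          rw [hb, add_comm]))
      rw [monomial_sub_monomial_mem_ker, weight_sumElim, weight_sumElim, weight_comp, weight_comp,
        weight_comp, weight_comp, AddMonoidHom.zero_apply, AddMonoidHom.zero_apply, add_zero,
        add_zero, ← sub_eq_zero] at hmem
      exact (QuotientAddGroup.eq_zero_iff _).1 hmem
    · rw [AddSubgroup.closure_le, Set.singleton_subset_iff]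
      exact ⟨(mem_closure_natToInt_iff s _).2 ⟨i, 0, by simp⟩,
        (mem_closure_natToInt_iff t _).2 ⟨j, 0, by simp [hw]⟩⟩
  · intro h
    apply le_antisymm
    · generalize hI : Ideal.span (α := MvPolynomial (Fin n ⊕ Fin m) κ) _ = I
      refine ker_monomialHom_le _ _ fun c c' hcc => ?_
      obtain ⟨a, b, rfl⟩ := exists_eq_mapDomain_inl_add_mapDomain_inr c
      obtain ⟨a', b', rfl⟩ := exists_eq_mapDomain_inl_add_mapDomain_inr c'
      rw [weight_sumElim, weight_sumElim] at hcc
      have hcc' := congrArg (natToInt d) hcc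
      rw [map_add, map_add] at hcc'
      have hx : natToInt d (Finsupp.weight s a) - natToInt d (Finsupp.weight s a') =
          natToInt d (Finsupp.weight t b') - natToInt d (Finsupp.weight t b) := by
        rw [sub_eq_sub_iff_add_eq_add, hcc', add_comm]
      have hmem := h.le ⟨(mem_closure_natToInt_iff s _).2 ⟨a, a', rfl⟩,
        (mem_closure_natToInt_iff t _).2 ⟨b', b, hx⟩⟩
      obtain ⟨k, hk⟩ := AddSubgroup.mem_closure_singleton.1 hmem
      have hgen := fun k a a' b b' => binomial_mem_of_weight_eq_add_nsmul (κ := κ) s t _ i j rfl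
        hw.symm I (fun f hf => hI.le (Ideal.subset_span (Or.inl (Or.inl ⟨f, hf, rfl⟩))))
        (fun f hf => hI.le (Ideal.subset_span (Or.inl (Or.inr ⟨f, hf, rfl⟩))))
        (hI.le (Ideal.subset_span (Or.inr rfl))) k (a := a) (a' := a') (b := b) (b' := b')
      obtain ⟨k, rfl | rfl⟩ := k.eq_nat_or_neg
      · rw [natCast_zsmul] at hk
        refine hgen k a a' b b' (natToInt_injective d ?_) (natToInt_injective d ?_)
        · rw [map_add, map_nsmul, hk]; abel
        · rw [map_add, map_nsmul, hk, hx]; abel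
      · rw [neg_smul, natCast_zsmul, neg_eq_iff_eq_neg] at hk
        rw [← neg_sub]
        refine neg_mem (hgen k a' a b' b (natToInt_injective d ?_) (natToInt_injective d ?_))
        · rw [map_add, map_nsmul, hk]; abel
        · rw [map_add, map_nsmul, hk, hx]; abel
    · rw [Ideal.span_le]
      rintro _ ((⟨f, hf, rfl⟩ | ⟨f, hf, rfl⟩) | rfl)
      · exact (ker_monomialHom_comp (Sum.elim s t) Sum.inl).le hf
      · exact (ker_monomialHom_comp (Sum.elim s t) Sum.inr).le hf
      · rw [rename_monomial, rename_monomial, SetLike.mem_coe, monomial_sub_monomial_mem_ker,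
          weight_mapDomain, weight_mapDomain, Sum.elim_comp_inl, Sum.elim_comp_inr, hw]
end

section
/- Let κ be a field, let S₁ be an additive submonoid of ℤ^{d₁} and S₂ an additive submonoid of ℕ^{d₂}, and let S be an additive commutative monoid with injective additive monoid homomorphisms f : S → S₁ and g : S → S₂. Assume every element of S₂ has a unique representation over the image g(S): every x ∈ S₂ can be written as x = g(c) + w with c ∈ S and w ∈ S₂ Apéry over g(S), and if g(c₁) + w₁ = g(c₂) + w₂ with w₁, w₂ Apéry over g(S) then c₁ = c₂ and w₁ = w₂. Let c be the additive congruence on S₁ × S₂ given by (s₁, s₂) ~ (t₁, t₂) iff there exist a, b ∈ S with s₁ + f(a) = t₁ + f(b) and s₂ + g(b) = t₂ + g(a), and let Q = (S₁ × S₂)/c be the quotient monoid. Then there is an isomorphism of AddMonoidAlgebra κ S-algebras between AddMonoidAlgebra κ Q and the tensor product (AddMonoidAlgebra κ S₁) ⊗_{AddMonoidAlgebra κ S} (AddMonoidAlgebra κ S₂), sending the monomial indexed by the class of (s₁, s₂) to u^{s₁} ⊗ u^{s₂}; here the algebra structures are induced by f and g via mapDomain. -/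
open scoped TensorProduct

/-- If every element of `M₂` has a unique Apéry representation over `g(S)` and `M₁` is cancellative,
then pairs related by the fibered-sum relation have the same Apéry part in `M₂`, and become equal
after moving their `g(S)`-parts to `M₁`. -/
theorem AperyOverImage.exists_common_part {S M₁ M₂ : Type*} [AddCommMonoid S]
    [AddCommMonoid M₁] [IsRightCancelAdd M₁] [AddCommMonoid M₂] (f : S →+ M₁) (g : S →+ M₂)
    (hrep : ∀ x : M₂, ∃ (c : S) (w : M₂), AperyOverImage g w ∧ x = g c + w)
    (huniq : ∀ (c₁ c₂ : S) (w₁ w₂ : M₂), AperyOverImage g w₁ → AperyOverImage g w₂ →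
      g c₁ + w₁ = g c₂ + w₂ → c₁ = c₂ ∧ w₁ = w₂)
    {p q : M₁ × M₂} {a b : S} (h₁ : p.1 + f a = q.1 + f b) (h₂ : p.2 + g b = q.2 + g a) :
    ∃ (c₁ c₂ : S) (w : M₂), p.2 = g c₁ + w ∧ q.2 = g c₂ + w ∧ p.1 + f c₁ = q.1 + f c₂ := by
  obtain ⟨c₁, w₁, hw₁, hp⟩ := hrep p.2
  obtain ⟨c₂, w₂, hw₂, hq⟩ := hrep q.2
  obtain ⟨hc, rfl⟩ := huniq (c₁ + b) (c₂ + a) w₁ w₂ hw₁ hw₂ (by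
    rw [hp, hq] at h₂
    rw [map_add, map_add, add_right_comm, h₂, add_right_comm])
  refine ⟨c₁, c₂, w₁, hp, hq, add_right_cancel (b := f b) ?_⟩
  calc p.1 + f c₁ + f b = p.1 + f (c₁ + b) := by rw [map_add, add_assoc]
    _ = p.1 + f a + f c₂ := by rw [hc, map_add, add_assoc, add_comm (f a)]
    _ = q.1 + f c₂ + f b := by rw [h₁, add_right_comm]

namespace AddMonoidAlgebra

variable {κ S M₁ M₂ : Type*} [CommRing κ] [AddCommMonoid S] [AddCommMonoid M₁] [AddCommMonoid M₂]
  [Algebra (AddMonoidAlgebra κ S) (AddMonoidAlgebra κ M₁)]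
  [Algebra (AddMonoidAlgebra κ S) (AddMonoidAlgebra κ M₂)]

/-- Monomials indexed by the image of `S` can be moved across the tensor product. -/
theorem single_add_tmul_single {f : S →+ M₁} {g : S →+ M₂}
    (hf : algebraMap (AddMonoidAlgebra κ S) (AddMonoidAlgebra κ M₁) = mapDomainRingHom κ f)
    (hg : algebraMap (AddMonoidAlgebra κ S) (AddMonoidAlgebra κ M₂) = mapDomainRingHom κ g)
    (s : M₁) (w : M₂) (c : S) :
    (single (s + f c) (1 : κ) : AddMonoidAlgebra κ M₁) ⊗ₜ[AddMonoidAlgebra κ S]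
        (single w (1 : κ) : AddMonoidAlgebra κ M₂) =
      single s (1 : κ) ⊗ₜ single (g c + w) (1 : κ) := by
  have h₁ : (single (s + f c) (1 : κ) : AddMonoidAlgebra κ M₁) =
      (single c (1 : κ) : AddMonoidAlgebra κ S) • single s (1 : κ) := by
    simp [Algebra.smul_def, hf, single_mul_single, add_comm]
  have h₂ : (single (g c + w) (1 : κ) : AddMonoidAlgebra κ M₂) =
      (single c (1 : κ) : AddMonoidAlgebra κ S) • single w (1 : κ) := by
    simp [Algebra.smul_def, hg, single_mul_single]
  rw [h₁, h₂, TensorProduct.smul_tmul]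

/-- The monoid homomorphism `(s₁, s₂) ↦ u^{s₁} ⊗ u^{s₂}`. -/
noncomputable def tmulMonomial (κ S M₁ M₂ : Type*) [CommRing κ] [AddCommMonoid S]
    [AddCommMonoid M₁] [AddCommMonoid M₂]
    [Algebra (AddMonoidAlgebra κ S) (AddMonoidAlgebra κ M₁)]
    [Algebra (AddMonoidAlgebra κ S) (AddMonoidAlgebra κ M₂)] :
    M₁ × M₂ →+
      Additive (AddMonoidAlgebra κ M₁ ⊗[AddMonoidAlgebra κ S] AddMonoidAlgebra κ M₂) where
  toFun p := Additive.ofMul (single p.1 (1 : κ) ⊗ₜ single p.2 (1 : κ))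
  map_zero' := rfl
  map_add' p q := by
    rw [← ofMul_mul, Algebra.TensorProduct.tmul_mul_tmul, single_mul_single, single_mul_single,
      one_mul, Prod.fst_add, Prod.snd_add]

/-- If `c` relates `(f s, 0)` to `(0, g s)`, and conversely related pairs give equal elementary
tensors of monomials, then `κ[(M₁ × M₂)/c]` is the tensor product `κ[M₁] ⊗ κ[M₂]` over `κ[S]`. -/
theorem exists_algEquiv_tensorProduct_of_addCon {f : S →+ M₁} {g : S →+ M₂} (c : AddCon (M₁ × M₂))
    [Algebra (AddMonoidAlgebra κ S) (AddMonoidAlgebra κ c.Quotient)]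
    (hf : algebraMap (AddMonoidAlgebra κ S) (AddMonoidAlgebra κ M₁) = mapDomainRingHom κ f)
    (hg : algebraMap (AddMonoidAlgebra κ S) (AddMonoidAlgebra κ M₂) = mapDomainRingHom κ g)
    (hQ : algebraMap (AddMonoidAlgebra κ S) (AddMonoidAlgebra κ c.Quotient) =
      mapDomainRingHom κ ((AddCon.mk' c).comp (f.prod 0)))
    (hfg : ∀ s, c (f s, 0) (0, g s))
    (hc : ∀ p q, c p q → tmulMonomial κ S M₁ M₂ p = tmulMonomial κ S M₁ M₂ q) :
    ∃ e : AddMonoidAlgebra κ c.Quotient ≃ₐ[AddMonoidAlgebra κ S]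
        (AddMonoidAlgebra κ M₁ ⊗[AddMonoidAlgebra κ S] AddMonoidAlgebra κ M₂),
      ∀ p : M₁ × M₂, e (single (p : c.Quotient) (1 : κ)) =
        single p.1 (1 : κ) ⊗ₜ single p.2 (1 : κ) := by
  let φ : κ →+* AddMonoidAlgebra κ M₁ ⊗[AddMonoidAlgebra κ S] AddMonoidAlgebra κ M₂ :=
    (algebraMap (AddMonoidAlgebra κ S) _).comp singleZeroRingHom
  let m : Multiplicative c.Quotient →* AddMonoidAlgebra κ M₁ ⊗[AddMonoidAlgebra κ S] AddMonoidAlgebra κ M₂ :=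
    AddMonoidHom.toMultiplicativeLeft (c.lift (tmulMonomial κ S M₁ M₂) hc)
  let F : AddMonoidAlgebra κ c.Quotient →+*
      AddMonoidAlgebra κ M₁ ⊗[AddMonoidAlgebra κ S] AddMonoidAlgebra κ M₂ :=
    liftNCRingHom φ m fun _ _ => Commute.all _ _
  have hF (p : M₁ × M₂) (r : κ) : F (single (p : c.Quotient) r) =
      single p.1 r ⊗ₜ single p.2 (1 : κ) := by
    have : F (single (p : c.Quotient) r) =
        φ r * (single p.1 (1 : κ) ⊗ₜ single p.2 (1 : κ)) := liftNC_single _ _ _ _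
    rw [this]
    simp [φ, Algebra.TensorProduct.algebraMap_apply, hf, single_mul_single]
  let i₁ : AddMonoidAlgebra κ M₁ →ₐ[AddMonoidAlgebra κ S] AddMonoidAlgebra κ c.Quotient :=
    { mapDomainRingHom κ (c.mk'.comp (AddMonoidHom.inl M₁ M₂)) with
      commutes' := fun x => by
        change mapDomainRingHom κ _ _ = _
        rw [hf, hQ]
        induction x using AddMonoidAlgebra.induction_linear with
        | zero => simp only [map_zero]
        | add x y hx hy => rw [map_add, map_add, map_add, hx, hy]
        | single s r => simp }
  let i₂ : AddMonoidAlgebra κ M₂ →ₐ[AddMonoidAlgebra κ S] AddMonoidAlgebra κ c.Quotient :=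
    { mapDomainRingHom κ (c.mk'.comp (AddMonoidHom.inr M₁ M₂)) with
      commutes' := fun x => by
        change mapDomainRingHom κ _ _ = _
        rw [hg, hQ]
        induction x using AddMonoidAlgebra.induction_linear with
        | zero => simp only [map_zero]
        | add x y hx hy => rw [map_add, map_add, map_add, hx, hy]
        | single s r => simpa using congrArg (single · r) ((AddCon.eq c).2 (hfg s)).symm }
  let G : AddMonoidAlgebra κ M₁ ⊗[AddMonoidAlgebra κ S] AddMonoidAlgebra κ M₂ →ₐ[AddMonoidAlgebra κ S]
      AddMonoidAlgebra κ c.Quotient :=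
    Algebra.TensorProduct.productMap i₁ i₂
  have hi₁ (s : M₁) (r : κ) : i₁ (single s r) = single (((s, 0) : M₁ × M₂) : c.Quotient) r :=
    mapDomain_single
  have hi₂ (s : M₂) (r : κ) : i₂ (single s r) = single (((0, s) : M₁ × M₂) : c.Quotient) r :=
    mapDomain_single
  have hG (s : M₁) (t : M₂) (r r' : κ) : G (single s r ⊗ₜ single t r') =
      single (((s, t) : M₁ × M₂) : c.Quotient) (r * r') := by
    simp only [G, Algebra.TensorProduct.productMap_apply_tmul, hi₁, hi₂, single_mul_single,
      ← AddCon.coe_add, Prod.mk_add_mk, add_zero, zero_add]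
  have hGF (x) : G (F x) = x := by
    induction x using AddMonoidAlgebra.induction_linear with
    | zero => simp
    | add x y hx hy => simp_all
    | single q r =>
      induction q using AddCon.induction_on with
      | H p => rw [hF, hG, mul_one]
  have hFi₁ (x) : F (i₁ x) = x ⊗ₜ 1 := by
    induction x using AddMonoidAlgebra.induction_linear with
    | zero => simp
    | add x y hx hy => simp_all [TensorProduct.add_tmul]
    | single s r => rw [hi₁, hF, one_def]
  have hscalar (r : κ) : (single (0 : M₁) r : AddMonoidAlgebra κ M₁) ⊗ₜ[AddMonoidAlgebra κ S]
      (1 : AddMonoidAlgebra κ M₂) = 1 ⊗ₜ single 0 r := by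
    simpa [Algebra.smul_def, hf, hg] using TensorProduct.smul_tmul
      (single (0 : S) r : AddMonoidAlgebra κ S) (1 : AddMonoidAlgebra κ M₁)
      (1 : AddMonoidAlgebra κ M₂)
  have hFi₂ (x) : F (i₂ x) = 1 ⊗ₜ x := by
    induction x using AddMonoidAlgebra.induction_linear with
    | zero => simp
    | add x y hx hy => simp_all [TensorProduct.tmul_add]
    | single s r =>
      have := congrArg (· * ((1 : AddMonoidAlgebra κ M₁) ⊗ₜ[AddMonoidAlgebra κ S]
        (single s (1 : κ) : AddMonoidAlgebra κ M₂))) (hscalar r)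
      simpa [hi₂, hF, single_mul_single] using this
  have hFG (x : AddMonoidAlgebra κ M₁ ⊗[AddMonoidAlgebra κ S] AddMonoidAlgebra κ M₂) : F (G x) = x := by
    induction x using TensorProduct.induction_on with
    | zero => simp
    | add x y hx hy => simp_all
    | tmul x y => simp [G, hFi₁, hFi₂]
  refine ⟨(AlgEquiv.ofBijective G ⟨Function.LeftInverse.injective hFG,
    Function.RightInverse.surjective hGF⟩).symm, fun p => ?_⟩
  rw [AlgEquiv.symm_apply_eq]
  exact (hG p.1 p.2 1 1).trans (by rw [one_mul]) |>.symm

end AddMonoidAlgebra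

/-- Let `S₁ ⊆ ℤ^{d₁}` and `S₂ ⊆ ℕ^{d₂}` be submonoids, `f : S →+ S₁`, `g : S →+ S₂`
injective homomorphisms, and assume every element of `S₂` has a unique representation over
`g(S)`.  Let `c` be the additive congruence on `S₁ × S₂` given by the fibered-sum relation
and `Q` the quotient monoid.  Then `κ[Q] ≃ κ[S₁] ⊗_{κ[S]} κ[S₂]` as `κ[S]`-algebras,
sending the monomial of the class of `(s₁, s₂)` to `u^{s₁} ⊗ u^{s₂}`. -/
theorem monoidAlgebra_fiberedSum_iso_tensorProduct
    (κ : Type*) [Field κ] (d₁ d₂ : ℕ)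
    (S₁ : AddSubmonoid (Fin d₁ → ℤ)) (S₂ : AddSubmonoid (Fin d₂ → ℕ))
    {S : Type*} [AddCommMonoid S]
    (f : S →+ ↥S₁) (hf : Function.Injective f)
    (g : S →+ ↥S₂) (hg : Function.Injective g)
    (hrep : ∀ x : ↥S₂, ∃ (c : S) (w : ↥S₂), AperyOverImage g w ∧ x = g c + w)
    (huniq : ∀ (c₁ c₂ : S) (w₁ w₂ : ↥S₂), AperyOverImage g w₁ → AperyOverImage g w₂ →
      g c₁ + w₁ = g c₂ + w₂ → c₁ = c₂ ∧ w₁ = w₂)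
    (c : AddCon (↥S₁ × ↥S₂))
    (hc : ∀ p q : ↥S₁ × ↥S₂,
      c p q ↔ ∃ a b : S, p.1 + f a = q.1 + f b ∧ p.2 + g b = q.2 + g a) :
    letI : Algebra (AddMonoidAlgebra κ S) (AddMonoidAlgebra κ ↥S₁) :=
      (AddMonoidAlgebra.mapDomainRingHom κ f).toAlgebra
    letI : Algebra (AddMonoidAlgebra κ S) (AddMonoidAlgebra κ ↥S₂) :=
      (AddMonoidAlgebra.mapDomainRingHom κ g).toAlgebra
    letI : Algebra (AddMonoidAlgebra κ S) (AddMonoidAlgebra κ c.Quotient) :=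
      (AddMonoidAlgebra.mapDomainRingHom κ ((AddCon.mk' c).comp (f.prod 0))).toAlgebra
    ∃ e : AddMonoidAlgebra κ c.Quotient
          ≃ₐ[AddMonoidAlgebra κ S]
            ((AddMonoidAlgebra κ ↥S₁) ⊗[AddMonoidAlgebra κ S] (AddMonoidAlgebra κ ↥S₂)),
      ∀ p : ↥S₁ × ↥S₂,
        e (AddMonoidAlgebra.single ((p : ↥S₁ × ↥S₂) : c.Quotient) (1 : κ))
          = AddMonoidAlgebra.single p.1 (1 : κ) ⊗ₜ AddMonoidAlgebra.single p.2 (1 : κ) := by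
  let : Algebra (AddMonoidAlgebra κ S) (AddMonoidAlgebra κ ↥S₁) :=
    (AddMonoidAlgebra.mapDomainRingHom κ f).toAlgebra
  let : Algebra (AddMonoidAlgebra κ S) (AddMonoidAlgebra κ ↥S₂) :=
    (AddMonoidAlgebra.mapDomainRingHom κ g).toAlgebra
  let : Algebra (AddMonoidAlgebra κ S) (AddMonoidAlgebra κ c.Quotient) :=
    (AddMonoidAlgebra.mapDomainRingHom κ ((AddCon.mk' c).comp (f.prod 0))).toAlgebra
  refine AddMonoidAlgebra.exists_algEquiv_tensorProduct_of_addCon (f := f) (g := g) c rfl rfl rfl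
    (fun s => (hc _ _).2 ⟨0, s, by simp, by simp⟩) fun p q hpq => ?_
  obtain ⟨a, b, h₁, h₂⟩ := (hc p q).1 hpq
  obtain ⟨c₁, c₂, w, hp, hq, h⟩ := AperyOverImage.exists_common_part f g hrep huniq h₁ h₂
  refine congrArg Additive.ofMul ?_
  rw [hp, hq, ← AddMonoidAlgebra.single_add_tmul_single (f := f) rfl rfl,
    ← AddMonoidAlgebra.single_add_tmul_single (f := f) rfl rfl, h]
end
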